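/- arXiv:1501.04714 — 2 statements merged into one kernel-verified Lean document; each statement's English description precedes it below -/
import Mathlib

section
/- Let τ ≥ 1 and θ irrational with ‖nθ‖ ≥ c/n^τ for all n ≥ 1 and some c > 0. Then for every positive non-increasing ψ with ∑_{n≥1} ψ(n)^τ = ∞, the inequality ‖nθ − s‖ < ψ(n) has infinitely many solutions n ∈ ℕ for almost all s ∈ ℝ. -/
open MeasureTheory Filter
open scoped ENNReal Classical

/-- Distance from a real number to the nearest integer. -/
noncomputable def distNearestInt (x : ℝ) : ℝ := |x - round x|

open Metric Set
open scoped Topology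

/-- The multiples `m • α`, `1 ≤ m < N`, stay at distance at least `1 / (2 * N)` from `0`. -/
def IsSeparatedScale (α : UnitAddCircle) (N : ℕ) : Prop :=
  ∀ m : ℕ, 1 ≤ m → m < N → 1 / (2 * (N : ℝ)) ≤ ‖m • α‖

lemma norm_nsmul_coe_eq_distNearestInt (θ : ℝ) (n : ℕ) :
    ‖n • (θ : UnitAddCircle)‖ = distNearestInt ((n : ℝ) * θ) := by
  rw [distNearestInt, ← UnitAddCircle.norm_eq, ← nsmul_eq_mul, AddCircle.coe_nsmul]

/-- If `q < m` are positive and `m * ‖q θ‖ < 1 / 2`, then `m` cannot improve on the approximation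
quality of `q`. -/
lemma distNearestInt_le_of_lt {θ : ℝ} {q m : ℕ} (hq : 0 < q) (hqm : q < m)
    (hm : 2 * (m : ℝ) * distNearestInt (q * θ) < 1) :
    distNearestInt (q * θ) ≤ distNearestInt (m * θ) := by
  by_contra! hlt
  unfold distNearestInt at *
  set p := round ((q : ℝ) * θ)
  set p' := round ((m : ℝ) * θ)
  have hq' : (0 : ℝ) < q := by exact_mod_cast hq
  have hqm' : (q : ℝ) < m := by exact_mod_cast hqm
  have hkey : ((m * p - q * p' : ℤ) : ℝ) = q * (m * θ - p') - m * (q * θ - p) := by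
    push_cast; ring
  have habs : |((m * p - q * p' : ℤ) : ℝ)| < 1 := by
    rw [hkey]
    calc |q * (m * θ - p') - m * (q * θ - p)|
        ≤ |q * (m * θ - p')| + |m * (q * θ - p)| := abs_sub _ _
      _ = q * |m * θ - p'| + m * |q * θ - p| := by
        rw [abs_mul, abs_mul, Nat.abs_cast, Nat.abs_cast]
      _ < 1 := by nlinarith [abs_nonneg (q * θ - p), abs_nonneg (m * θ - p')]
  have hzero : (m * p - q * p' : ℤ) = 0 := by
    rw [← Int.abs_lt_one_iff]
    exact_mod_cast habs
  rw [hzero] at hkey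
  have heq : (q : ℝ) * |m * θ - p'| = m * |q * θ - p| := by
    rw [← Nat.abs_cast q, ← Nat.abs_cast m, ← abs_mul, ← abs_mul, Nat.abs_cast, Nat.abs_cast]
    congr 1
    simp only [Int.cast_zero] at hkey
    linarith
  nlinarith [abs_nonneg (q * θ - p), abs_nonneg (m * θ - p')]

lemma exists_isSeparatedScale {θ τ c : ℝ} (hτ : 1 ≤ τ) (hc : 0 < c)
    (hbad : ∀ n : ℕ, 1 ≤ n → c / (n : ℝ) ^ τ ≤ distNearestInt ((n : ℝ) * θ)) :
    ∃ C : ℝ, 0 < C ∧ ∀ X : ℕ, 1 ≤ X →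
      ∃ N : ℕ, X ≤ N ∧ (N : ℝ) ≤ C * (X : ℝ) ^ τ ∧ IsSeparatedScale (θ : UnitAddCircle) N := by
  refine ⟨2 ^ τ / (2 * c) + 1, by positivity, fun X hX => ?_⟩
  have hX' : (1 : ℝ) ≤ X := by exact_mod_cast hX
  obtain ⟨q, hqmem, hqmin⟩ := Finset.exists_min_image (Finset.Icc 1 (2 * X))
    (fun m => distNearestInt ((m : ℝ) * θ)) ⟨1, by simp; omega⟩
  rw [Finset.mem_Icc] at hqmem
  set δ := distNearestInt ((q : ℝ) * θ) with hδ
  have hq0 : (0 : ℝ) < q := by exact_mod_cast hqmem.1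
  have hδlow : c / (2 ^ τ * (X : ℝ) ^ τ) ≤ δ := by
    refine le_trans ?_ (hbad q hqmem.1)
    rw [← Real.mul_rpow (by norm_num) (by positivity)]
    have : (q : ℝ) ≤ 2 * X := by exact_mod_cast hqmem.2
    gcongr
  have hδpos : 0 < δ := lt_of_lt_of_le (by positivity) hδlow
  have hδup : δ ≤ 1 / (2 * X) := by
    obtain ⟨k, hk0, hk, hkle⟩ := Real.exists_nat_abs_mul_sub_round_le θ (n := 2 * X) (by omega)
    refine (hqmin k (Finset.mem_Icc.2 ⟨hk0, hk⟩)).trans (hkle.trans ?_)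
    push_cast
    gcongr
    linarith
  have hceil : 1 / (2 * δ) ≤ (⌈1 / (2 * δ)⌉₊ : ℝ) := Nat.le_ceil _
  refine ⟨⌈1 / (2 * δ)⌉₊, ?_, ?_, ?_⟩
  · have : (X : ℝ) ≤ 1 / (2 * δ) := by
      rw [le_div_iff₀ (by positivity)] at hδup ⊢
      linarith
    exact_mod_cast this.trans hceil
  · have h1 : (⌈1 / (2 * δ)⌉₊ : ℝ) < 1 / (2 * δ) + 1 := Nat.ceil_lt_add_one (by positivity)
    have h2 : 1 / (2 * δ) ≤ 2 ^ τ / (2 * c) * (X : ℝ) ^ τ := by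
      rw [div_le_iff₀ (by positivity)] at hδlow
      rw [div_mul_eq_mul_div, div_le_div_iff₀ (by positivity) (by positivity)]
      linarith
    have h3 : (1 : ℝ) ≤ (X : ℝ) ^ τ := Real.one_le_rpow hX' (by linarith)
    linarith
  · intro m hm1 hmN
    rw [norm_nsmul_coe_eq_distNearestInt]
    have hN : 1 / (2 * (⌈1 / (2 * δ)⌉₊ : ℝ)) ≤ δ := by
      have : (0 : ℝ) < ⌈1 / (2 * δ)⌉₊ := lt_of_lt_of_le (by positivity) hceil
      rw [div_le_iff₀ (by positivity)] at hceil ⊢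
      linarith
    refine hN.trans ?_
    rcases le_or_gt m (2 * X) with h | h
    · exact hqmin m (Finset.mem_Icc.2 ⟨hm1, h⟩)
    · refine distNearestInt_le_of_lt (by omega) (by omega) ?_
      rw [Nat.lt_ceil, lt_div_iff₀ (by positivity)] at hmN
      linarith

lemma volume_real_closedBall_unitAddCircle (x : UnitAddCircle) {ε : ℝ} (hε : 0 ≤ ε) :
    volume.real (closedBall x ε) = min 1 (2 * ε) := by
  rw [Measure.real, AddCircle.volume_closedBall, ENNReal.toReal_ofReal (by positivity)]

/-- The balls of radius `δ` around well-spaced points `y n` near a finite union of balls `V` are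
controlled by the measure of `V` and the number of balls in `V`. -/
lemma card_mul_le_of_inter_nonempty (F : Finset (UnitAddCircle × ℝ))
    (hF : ∀ p ∈ F, 0 ≤ p.2 ∧ p.2 ≤ 1 / 2) (G : Finset ℕ) (y : ℕ → UnitAddCircle) (R : ℕ → ℝ)
    {δ : ℝ} (hδ0 : 0 ≤ δ) (hδ : δ ≤ 1 / 2)
    (hsep : ∀ m ∈ G, ∀ n ∈ G, m ≠ n → 2 * δ < dist (y m) (y n))
    (hR : ∀ n ∈ G, R n ≤ δ)
    (hmeet : ∀ n ∈ G, (closedBall (y n) (R n) ∩ ⋃ p ∈ F, closedBall p.1 p.2).Nonempty) :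
    2 * δ * G.card ≤ 5 * volume.real (⋃ p ∈ F, closedBall p.1 p.2) + 4 * δ * F.card := by
  obtain ⟨u, huF, hdisj, hcov⟩ := Vitali.exists_disjoint_subfamily_covering_enlargement_closedBall
    (F : Set (UnitAddCircle × ℝ)) Prod.fst Prod.snd (1 / 2) (fun p hp => (hF p hp).2) 5
    (by norm_num)
  lift u to Finset (UnitAddCircle × ℝ) using F.finite_toSet.subset huF
  rw [Finset.coe_subset] at huF
  have hleft : volume.real (⋃ n ∈ G, closedBall (y n) δ) = 2 * δ * G.card := by
    rw [measureReal_biUnion_finset]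
    · rw [Finset.sum_congr rfl fun n _ => volume_real_closedBall_unitAddCircle (y n) hδ0,
        Finset.sum_const, nsmul_eq_mul, min_eq_right (by linarith), mul_comm]
    · intro m hm n hn hmn
      exact closedBall_disjoint_closedBall (by linarith [hsep m hm n hn hmn])
    · exact fun _ _ => isClosed_closedBall.measurableSet
  have hsub : (⋃ n ∈ G, closedBall (y n) δ) ⊆ ⋃ p ∈ u, closedBall p.1 (5 * p.2 + 2 * δ) := by
    simp only [iUnion_subset_iff]
    intro n hn w hw
    obtain ⟨z, hz, hzV⟩ := hmeet n hn
    simp only [mem_iUnion] at hzV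
    obtain ⟨p, hp, hzp⟩ := hzV
    obtain ⟨b, hb, hpb⟩ := hcov p hp
    have h1 := mem_closedBall.1 (hpb hzp)
    have h2 := mem_closedBall'.1 hz
    have h3 := mem_closedBall.1 hw
    simp only [mem_iUnion]
    refine ⟨b, hb, mem_closedBall.2 ?_⟩
    linarith [hR n hn, dist_triangle4 w (y n) z b.1]
  have hu : ∑ p ∈ u, 2 * p.2 ≤ volume.real (⋃ p ∈ F, closedBall p.1 p.2) := by
    calc ∑ p ∈ u, 2 * p.2 = volume.real (⋃ p ∈ u, closedBall p.1 p.2) := by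
          rw [measureReal_biUnion_finset hdisj fun _ _ => isClosed_closedBall.measurableSet]
          refine Finset.sum_congr rfl fun p hp => ?_
          obtain ⟨h0, h1⟩ := hF p (huF hp)
          rw [volume_real_closedBall_unitAddCircle _ h0, min_eq_right (by linarith)]
      _ ≤ _ := measureReal_mono (biUnion_subset_biUnion_left huF) (measure_ne_top _ _)
  calc 2 * δ * G.card ≤ volume.real (⋃ p ∈ u, closedBall p.1 (5 * p.2 + 2 * δ)) :=
        hleft ▸ measureReal_mono hsub (measure_ne_top _ _)
    _ ≤ ∑ p ∈ u, volume.real (closedBall p.1 (5 * p.2 + 2 * δ)) :=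
        measureReal_biUnion_finset_le _ _
    _ ≤ ∑ p ∈ u, (5 * (2 * p.2) + 4 * δ) := by
        refine Finset.sum_le_sum fun p hp => ?_
        have h0 := (hF p (huF hp)).1
        rw [volume_real_closedBall_unitAddCircle _ (by positivity)]
        exact (min_le_right _ _).trans (by linarith)
    _ = 5 * ∑ p ∈ u, 2 * p.2 + 4 * δ * u.card := by
        rw [Finset.sum_add_distrib, ← Finset.mul_sum, Finset.sum_const, nsmul_eq_mul,
          mul_comm (4 * δ)]
    _ ≤ _ := by
        have : (u.card : ℝ) ≤ F.card := by exact_mod_cast Finset.card_le_card huF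
        gcongr

/-- If `P` holds on at least half of every block `[j h, (j + 1) h)`, `j ≥ 1`, then the sum of an
antitone function over `[2 h, M)` is at most twice its sum over the points of `[h, M)`
satisfying `P`. -/
lemma sum_Ico_le_two_mul_sum_filter {f : ℕ → ℝ} (hf : Antitone f) (hf0 : ∀ n, 0 ≤ f n)
    {h : ℕ} (hh : 1 ≤ h) (M : ℕ) (P : ℕ → Prop)
    (hP : ∀ j, 1 ≤ j → h ≤ 2 * ((Finset.Ico (j * h) ((j + 1) * h)).filter P).card) :
    ∑ n ∈ Finset.Ico (2 * h) M, f n ≤ 2 * ∑ n ∈ (Finset.Ico h M).filter P, f n := by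
  set g : ℕ → ℝ := fun n => if n < M then f n else 0 with hg
  have hg0 : ∀ n, 0 ≤ g n := fun n => by simp only [hg]; split_ifs <;> simp [hf0]
  have hganti : Antitone g := by
    intro a b hab
    simp only [hg]
    split_ifs with h1 h2
    · exact hf hab
    · omega
    · exact hf0 a
    · exact le_rfl
  have hblock : ∀ J : ℕ, ∑ n ∈ Finset.Ico (2 * h) ((J + 2) * h), g n ≤
      2 * ∑ n ∈ Finset.Ico h ((J + 1) * h), if P n then g n else 0 := by
    intro J
    induction J with
    | zero => simp
    | succ J ih =>
      rw [← Finset.sum_Ico_consecutive _ (show 2 * h ≤ (J + 2) * h by nlinarith)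
          (show (J + 2) * h ≤ (J + 1 + 2) * h by nlinarith),
        ← Finset.sum_Ico_consecutive _ (show h ≤ (J + 1) * h by nlinarith)
          (show (J + 1) * h ≤ (J + 1 + 1) * h by nlinarith), mul_add]
      refine add_le_add ih ?_
      calc ∑ n ∈ Finset.Ico ((J + 2) * h) ((J + 1 + 2) * h), g n
          ≤ ∑ n ∈ Finset.Ico ((J + 2) * h) ((J + 1 + 2) * h), g ((J + 2) * h) :=
            Finset.sum_le_sum fun n hn => hganti (Finset.mem_Ico.1 hn).1
        _ = h * g ((J + 2) * h) := by
            rw [Finset.sum_const, Nat.card_Ico, nsmul_eq_mul, ← Nat.sub_mul]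
            congr 2
            rw [show J + 1 + 2 - (J + 2) = 1 by omega, one_mul]
        _ ≤ 2 * (((Finset.Ico ((J + 1) * h) ((J + 1 + 1) * h)).filter P).card *
              g ((J + 2) * h)) := by
            rw [← mul_assoc]
            refine mul_le_mul_of_nonneg_right ?_ (hg0 _)
            exact_mod_cast hP (J + 1) (by omega)
        _ ≤ 2 * ∑ n ∈ (Finset.Ico ((J + 1) * h) ((J + 1 + 1) * h)).filter P, g n := by
            rw [← nsmul_eq_mul, ← Finset.sum_const]
            refine mul_le_mul_of_nonneg_left (Finset.sum_le_sum fun n hn => hganti ?_) zero_le_two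
            exact (Finset.mem_Ico.1 (Finset.mem_filter.1 hn).1).2.le
        _ = _ := by rw [Finset.sum_filter]
  have hM : M ≤ (M + 1) * h := by nlinarith
  calc ∑ n ∈ Finset.Ico (2 * h) M, f n = ∑ n ∈ Finset.Ico (2 * h) M, g n :=
        Finset.sum_congr rfl fun n hn => by simp [hg, (Finset.mem_Ico.1 hn).2]
    _ ≤ ∑ n ∈ Finset.Ico (2 * h) ((M + 2) * h), g n :=
        Finset.sum_le_sum_of_subset_of_nonneg
          (Finset.Ico_subset_Ico_right (by nlinarith)) fun n _ _ => hg0 n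
    _ ≤ 2 * ∑ n ∈ Finset.Ico h ((M + 1) * h), if P n then g n else 0 := hblock M
    _ = 2 * ∑ n ∈ (Finset.Ico h M).filter P, f n := by
        congr 1
        rw [Finset.sum_filter]
        symm
        refine Finset.sum_subset_zero_on_sdiff (Finset.Ico_subset_Ico_right hM) ?_ ?_
        · intro n hn
          simp only [Finset.mem_sdiff, Finset.mem_Ico] at hn
          have : ¬ n < M := by omega
          simp [hg, this]
        · intro n hn
          simp [hg, (Finset.mem_Ico.1 hn).2]

lemma IsSeparatedScale.le_dist {α : UnitAddCircle} {N : ℕ} (hN : IsSeparatedScale α N)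
    {m n : ℕ} (hmn : m ≠ n) (h1 : m < n + N) (h2 : n < m + N) :
    1 / (2 * (N : ℝ)) ≤ dist (m • α) (n • α) := by
  wlog hlt : m < n generalizing m n
  · rw [dist_comm]
    exact this hmn.symm h2 h1 (by omega)
  rw [dist_comm, dist_eq_norm, sub_eq_add_neg, ← sub_nsmul _ hlt.le]
  exact hN _ (by omega) (by omega)

/-- A sum of radii over the orbit points with indices in `[q, q')` is bounded by the measure that
the balls with indices in `[q / 2, q')` contribute outside a small union of few balls. -/
lemma IsSeparatedScale.sum_le_measureReal_diff {α : UnitAddCircle} {q q' : ℕ}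
    (hq : IsSeparatedScale α q) (hq' : IsSeparatedScale α q') (hq2 : 2 ≤ q) (hqq' : q ≤ q')
    {F : Finset (UnitAddCircle × ℝ)} (hF : ∀ p ∈ F, 0 ≤ p.2 ∧ p.2 ≤ 1 / 2)
    (hFcard : 24 * F.card ≤ q)
    (hV : volume.real (⋃ p ∈ F, closedBall p.1 p.2) ≤ 1 / 240)
    {R : ℕ → ℝ} (hR : Antitone R) (hR0 : ∀ n, 0 ≤ R n) (hRle : ∀ n, R n ≤ 1 / (8 * (q' : ℝ))) :
    ∑ n ∈ Finset.Ico q q', R n ≤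
      volume.real ((⋃ n ∈ Finset.Ico (q / 2) q', closedBall (n • α) (R n)) \
        ⋃ p ∈ F, closedBall p.1 p.2) := by
  set V := ⋃ p ∈ F, closedBall p.1 p.2 with hVdef
  set P : ℕ → Prop := fun n => Disjoint (closedBall (n • α) (R n)) V
  have hq0 : (2 : ℝ) ≤ q := by exact_mod_cast hq2
  have hqq'R : (q : ℝ) ≤ q' := by exact_mod_cast hqq'
  have hblock : ∀ j, 1 ≤ j →
      q / 2 ≤ 2 * ((Finset.Ico (j * (q / 2)) ((j + 1) * (q / 2))).filter P).card := by
    intro j _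
    have hadd := Finset.card_filter_add_card_filter_not
      (s := Finset.Ico (j * (q / 2)) ((j + 1) * (q / 2))) P
    rw [Nat.card_Ico, ← Nat.sub_mul, Nat.add_sub_cancel_left, one_mul] at hadd
    set G := (Finset.Ico (j * (q / 2)) ((j + 1) * (q / 2))).filter fun n => ¬ P n with hG
    have hcount := card_mul_le_of_inter_nonempty F hF G (fun n => n • α) R
      (δ := 1 / (8 * q)) (by positivity)
      (by rw [div_le_div_iff₀ (by positivity) (by positivity)]; linarith)
      (by
        intro m hm n hn hmn
        simp only [hG, Finset.mem_filter, Finset.mem_Ico, add_mul, one_mul] at hm hn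
        refine lt_of_lt_of_le ?_ (hq.le_dist hmn (by omega) (by omega))
        rw [mul_one_div, div_lt_div_iff₀ (by positivity) (by positivity)]
        linarith)
      (fun n _ => (hRle n).trans (by gcongr))
      (fun n hn => not_disjoint_iff_nonempty_inter.1 (Finset.mem_filter.1 hn).2)
    have hF' : (24 : ℝ) * F.card ≤ q := by exact_mod_cast hFcard
    have hG6 : (6 : ℝ) * G.card ≤ q := by
      have e1 : 2 * (1 / (8 * (q : ℝ))) * G.card * (4 * q) = G.card := by
        field_simp; ring
      have e2 : 4 * (1 / (8 * (q : ℝ))) * F.card * (4 * q) = 2 * F.card := by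
        field_simp; ring
      have := mul_le_mul_of_nonneg_right hcount (show (0 : ℝ) ≤ 4 * q by positivity)
      rw [e1, add_mul, e2] at this
      nlinarith
    have hG6' : 6 * G.card ≤ q := by exact_mod_cast hG6
    omega
  have hsum := sum_Ico_le_two_mul_sum_filter hR hR0 (show 1 ≤ q / 2 by omega) q' P hblock
  have hRhalf : ∀ n, 2 * R n ≤ 1 := fun n => by
    have : 1 / (8 * (q' : ℝ)) ≤ 1 / 2 := by
      rw [div_le_div_iff₀ (by linarith) (by norm_num)]; linarith
    linarith [hRle n]
  calc ∑ n ∈ Finset.Ico q q', R n ≤ ∑ n ∈ Finset.Ico (2 * (q / 2)) q', R n :=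
        Finset.sum_le_sum_of_subset_of_nonneg
          (Finset.Ico_subset_Ico_left (by omega)) fun n _ _ => hR0 n
    _ ≤ ∑ n ∈ (Finset.Ico (q / 2) q').filter P, 2 * R n := by rwa [← Finset.mul_sum]
    _ = volume.real (⋃ n ∈ (Finset.Ico (q / 2) q').filter P, closedBall (n • α) (R n)) := by
        rw [measureReal_biUnion_finset]
        · refine Finset.sum_congr rfl fun n _ => ?_
          rw [volume_real_closedBall_unitAddCircle _ (hR0 n), min_eq_right (hRhalf n)]
        · intro m hm n hn hmn
          simp only [Finset.coe_filter, Finset.mem_Ico, mem_ofPred_eq] at hm hn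
          refine closedBall_disjoint_closedBall (lt_of_lt_of_le ?_
            (hq'.le_dist hmn (by omega) (by omega)))
          have : 2 * (1 / (8 * (q' : ℝ))) < 1 / (2 * q') := by
            rw [mul_one_div, div_lt_div_iff₀ (by linarith) (by linarith)]
            linarith
          linarith [hRle m, hRle n]
        · exact fun _ _ => isClosed_closedBall.measurableSet
    _ ≤ _ := by
        refine measureReal_mono ?_ (measure_ne_top _ _)
        simp only [iUnion_subset_iff]
        intro n hn
        rw [Finset.mem_filter] at hn
        exact subset_sdiff.2 ⟨subset_biUnion_of_mem (u := fun n : ℕ => closedBall (n • α) (R n))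
          (Finset.mem_coe.2 hn.1), hn.2⟩

lemma sum_range_sum_Ico_le_of_measureReal_le {α : UnitAddCircle} {ψ : ℕ → ℝ}
    (hψpos : ∀ n, 0 < ψ n) (hψ : Antitone ψ) {N : ℕ}
    (hN : volume.real (⋃ n ≥ N, closedBall (n • α) (ψ n / 2)) ≤ 1 / 240)
    {q q' : ℕ → ℕ} (hqN : ∀ i, N ≤ q i / 2) (hq2 : ∀ i, 2 ≤ q i) (hqq' : ∀ i, q i ≤ q' i)
    (hgrow : ∀ i, 48 * q' i ≤ q (i + 1))
    (hq : ∀ i, IsSeparatedScale α (q i)) (hq' : ∀ i, IsSeparatedScale α (q' i)) (k : ℕ) :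
    ∑ i ∈ Finset.range k, ∑ n ∈ Finset.Ico (q i) (q' i), min (ψ n / 2) (1 / (8 * (q' i : ℝ))) ≤
      1 / 240 := by
  set R : ℕ → ℕ → ℝ := fun i n => min (ψ n / 2) (1 / (8 * (q' i : ℝ))) with hRdef
  have hR0 : ∀ i n, 0 ≤ R i n := fun i n => le_min (by linarith [hψpos n]) (by positivity)
  have hRle : ∀ i n, R i n ≤ 1 / (8 * (q' i : ℝ)) := fun i n => min_le_right _ _
  have hRanti : ∀ i, Antitone (R i) := fun i m n hmn =>
    min_le_min_right _ (by linarith [hψ hmn])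
  set L : ℕ → Finset (UnitAddCircle × ℝ) := fun i =>
    (Finset.Ico (q i / 2) (q' i)).image fun n => (n • α, R i n) with hL
  set F : ℕ → Finset (UnitAddCircle × ℝ) := fun k => (Finset.range k).biUnion L with hFdef
  have hFsucc : ∀ k, F (k + 1) = L k ∪ F k := fun k => by
    simp only [hFdef, Finset.range_add_one, Finset.biUnion_insert]
  have hFmem : ∀ k, ∀ p ∈ F k, ∃ i, ∃ n, q i / 2 ≤ n ∧ p = (n • α, R i n) := by
    intro k p hp
    simp only [hFdef, hL, Finset.mem_biUnion, Finset.mem_image, Finset.mem_Ico] at hp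
    obtain ⟨i, -, n, hn, rfl⟩ := hp
    exact ⟨i, n, hn.1, rfl⟩
  have hFrad : ∀ k, ∀ p ∈ F k, 0 ≤ p.2 ∧ p.2 ≤ 1 / 2 := by
    intro k p hp
    obtain ⟨i, n, -, rfl⟩ := hFmem k p hp
    refine ⟨hR0 i n, (hRle i n).trans ?_⟩
    have : (2 : ℝ) ≤ q' i := by exact_mod_cast (hq2 i).trans (hqq' i)
    rw [div_le_div_iff₀ (by linarith) (by norm_num)]
    linarith
  have hFvol : ∀ k, volume.real (⋃ p ∈ F k, closedBall p.1 p.2) ≤ 1 / 240 := by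
    intro k
    refine (measureReal_mono ?_ (measure_ne_top _ _)).trans hN
    simp only [iUnion_subset_iff]
    intro p hp
    obtain ⟨i, n, hn, rfl⟩ := hFmem k p hp
    exact (closedBall_subset_closedBall (min_le_left _ _)).trans
      (subset_biUnion_of_mem (u := fun n : ℕ => closedBall (n • α) (ψ n / 2))
        (show n ∈ {n | N ≤ n} from (hqN i).trans hn))
  have hFcard : ∀ k, 24 * (F k).card ≤ q k := by
    intro k
    induction k with
    | zero => simp [hFdef]
    | succ k ih =>
      have h1 : (L k).card ≤ q' k :=
        Finset.card_image_le.trans (by rw [Nat.card_Ico]; omega)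
      have h2 : (F (k + 1)).card ≤ (L k).card + (F k).card := by
        rw [hFsucc]; exact Finset.card_union_le _ _
      have h3 := hgrow k
      have h4 := hqq' k
      omega
  refine le_trans ?_ (hFvol k)
  induction k with
  | zero => simp
  | succ k ih =>
    have hstep := (hq k).sum_le_measureReal_diff (hq' k) (hq2 k) (hqq' k) (hFrad k) (hFcard k)
      (hFvol k) (hRanti k) (hR0 k) (hRle k)
    have hunion : (⋃ p ∈ F (k + 1), closedBall p.1 p.2) =
        (⋃ p ∈ F k, closedBall p.1 p.2) ∪
          ((⋃ n ∈ Finset.Ico (q k / 2) (q' k), closedBall (n • α) (R k n)) \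
            ⋃ p ∈ F k, closedBall p.1 p.2) := by
      rw [union_sdiff_self, hFsucc, Finset.set_biUnion_union, union_comm, hL,
        Finset.set_biUnion_finset_image]
    rw [Finset.sum_range_succ, hunion,
      measureReal_union disjoint_sdiff_right ?_ (measure_ne_top _ _) (measure_ne_top _ _)]
    · exact add_le_add ih hstep
    · exact (Finset.measurableSet_biUnion _ fun _ _ => isClosed_closedBall.measurableSet).diff
        (Finset.measurableSet_biUnion _ fun _ _ => isClosed_closedBall.measurableSet)

lemma summable_rpow_of_measureReal_le {θ τ c : ℝ} (hτ : 1 ≤ τ) (hc : 0 < c)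
    (hbad : ∀ n : ℕ, 1 ≤ n → c / (n : ℝ) ^ τ ≤ distNearestInt ((n : ℝ) * θ))
    {ψ : ℕ → ℝ} (hψpos : ∀ n, 0 < ψ n) (hψ : Antitone ψ) {N : ℕ}
    (hN : volume.real (⋃ n ≥ N, closedBall (n • (θ : UnitAddCircle)) (ψ n / 2)) ≤ 1 / 240) :
    Summable fun n => ψ n ^ τ := by
  obtain ⟨C, hC, hCX⟩ := exists_isSeparatedScale hτ hc hbad
  choose! scale hscale_ge hscale_le hscale_sep using hCX
  set Q : ℕ → ℕ := fun i => Nat.rec (scale (2 * N + 2)) (fun _ Q => scale (48 * Q)) i with hQ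
  have hQsucc : ∀ i, Q (i + 1) = scale (48 * Q i) := fun i => rfl
  have hQge : ∀ i, 2 * N + 2 ≤ Q i := by
    intro i
    induction i with
    | zero => exact hscale_ge _ (by omega)
    | succ i ih =>
      have := hscale_ge (48 * Q i) (by omega)
      rw [← hQsucc] at this
      omega
  have hQgrow : ∀ i, 48 * Q i ≤ Q (i + 1) := fun i =>
    hscale_ge (48 * Q i) (by have := hQge i; omega)
  have hQsep : ∀ i, IsSeparatedScale (θ : UnitAddCircle) (Q i) := by
    intro i
    cases i with
    | zero => exact hscale_sep _ (by omega)
    | succ i => exact hscale_sep (48 * Q i) (by have := hQge i; omega)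
  have hQle : ∀ i, (Q (i + 1) : ℝ) ≤ C * 48 ^ τ * (Q i : ℝ) ^ τ := by
    intro i
    have := hscale_le (48 * Q i) (by have := hQge i; omega)
    rw [← hQsucc] at this
    push_cast at this
    rwa [Real.mul_rpow (by norm_num) (by positivity), ← mul_assoc] at this
  have hQmono : StrictMono Q := strictMono_nat_of_lt_succ fun i => by
    have := hQge i; have := hQgrow i; omega
  set S : ℕ → ℝ := fun i =>
    ∑ n ∈ Finset.Ico (Q i) (Q (i + 1)), min (ψ n / 2) (1 / (8 * (Q (i + 1) : ℝ))) with hS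
  have hterm0 : ∀ i n, 0 ≤ min (ψ n / 2) (1 / (8 * (Q (i + 1) : ℝ))) := fun i n =>
    le_min (by linarith [hψpos n]) (by positivity)
  have hS0 : ∀ i, 0 ≤ S i := fun i => Finset.sum_nonneg fun n _ => hterm0 i n
  have hpart : ∀ p, Summable fun i => S (2 * i + p) := by
    intro p
    refine summable_of_sum_range_le (fun i => hS0 _)
      (sum_range_sum_Ico_le_of_measureReal_le hψpos hψ hN (q := fun i => Q (2 * i + p))
        (q' := fun i => Q (2 * i + p + 1)) ?_ ?_ ?_ ?_ (fun i => hQsep _)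
        fun i => hQsep (2 * i + p + 1))
    · intro i; have := hQge (2 * i + p); omega
    · intro i; have := hQge (2 * i + p); omega
    · intro i; exact (hQmono (Nat.lt_succ_self _)).le
    · intro i
      have := hQgrow (2 * i + p + 1)
      rwa [show 2 * i + p + 1 + 1 = 2 * (i + 1) + p by ring] at this
  have hSsum : Summable S := (hpart 0).even_add_odd (hpart 1)
  have hψQ : ∀ᶠ i in atTop, ψ (Q (i + 1)) < 1 / (Q (i + 1) : ℝ) := by
    filter_upwards [hSsum.tendsto_atTop_zero.eventually_lt_const
      (show (0 : ℝ) < 1 / 16 by norm_num)] with i hi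
    by_contra! hle
    refine hi.not_ge ?_
    have hpos : (0 : ℝ) < Q (i + 1) := by
      have := hQge (i + 1); exact_mod_cast (by omega : 0 < Q (i + 1))
    have hgrow : (48 : ℝ) * Q i ≤ Q (i + 1) := by exact_mod_cast hQgrow i
    calc (1 : ℝ) / 16 = (Q (i + 1) / 2) * (1 / (8 * (Q (i + 1) : ℝ))) := by
          field_simp; norm_num
      _ ≤ ((Q (i + 1) : ℝ) - Q i) * (1 / (8 * (Q (i + 1) : ℝ))) := by
          gcongr; linarith [(Nat.cast_nonneg (Q i) : (0 : ℝ) ≤ Q i)]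
      _ = ∑ n ∈ Finset.Ico (Q i) (Q (i + 1)), 1 / (8 * (Q (i + 1) : ℝ)) := by
          rw [Finset.sum_const, Nat.card_Ico, nsmul_eq_mul,
            Nat.cast_sub (hQmono (Nat.lt_succ_self i)).le]
      _ ≤ S i := by
          refine Finset.sum_le_sum fun n hn => le_min ?_ le_rfl
          have h1 := hψ (Finset.mem_Ico.1 hn).2.le
          have h2 : 1 / (8 * (Q (i + 1) : ℝ)) ≤ 1 / Q (i + 1) / 2 := by
            rw [div_div]
            exact one_div_le_one_div_of_le (by positivity) (by linarith)
          linarith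
  obtain ⟨I, hI⟩ := eventually_atTop.1 hψQ
  set D : ℝ := 2 + 8 * (C * 48 ^ τ) with hD
  have hD0 : 0 ≤ D := by positivity
  have hblock : ∀ i, I + 1 ≤ i → ∑ n ∈ Finset.Ico (Q i) (Q (i + 1)), ψ n ^ τ ≤ D * S i := by
    intro i hi
    obtain ⟨i, rfl⟩ : ∃ k, i = k + 1 := ⟨i - 1, by omega⟩
    rw [hS, Finset.mul_sum]
    refine Finset.sum_le_sum fun n hn => ?_
    have hQ1 : (1 : ℝ) ≤ Q (i + 1) := by
      have := hQge (i + 1); exact_mod_cast (by omega : 1 ≤ Q (i + 1))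
    have hQ2 : (0 : ℝ) < Q (i + 1 + 1) := by
      have := hQge (i + 1 + 1); exact_mod_cast (by omega : 0 < Q (i + 1 + 1))
    have h1 : ψ n ≤ 1 / Q (i + 1) :=
      (hψ (Finset.mem_Ico.1 hn).1).trans (hI i (by omega)).le
    have h2 : ψ n ^ τ ≤ ψ n :=
      Real.rpow_le_self_of_le_one (hψpos n).le
        (h1.trans (div_le_one_of_le₀ hQ1 (by positivity))) hτ
    have h3 : ψ n ^ τ ≤ C * 48 ^ τ / Q (i + 1 + 1) := by
      calc ψ n ^ τ ≤ (1 / (Q (i + 1) : ℝ)) ^ τ :=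
            Real.rpow_le_rpow (hψpos n).le h1 (by linarith)
        _ = 1 / (Q (i + 1) : ℝ) ^ τ := by
            rw [Real.div_rpow zero_le_one (by positivity), Real.one_rpow]
        _ ≤ C * 48 ^ τ / Q (i + 1 + 1) := by
            rw [div_le_div_iff₀ (by positivity) hQ2]
            linarith [hQle (i + 1)]
    rw [mul_min_of_nonneg _ _ hD0]
    refine le_min ?_ ?_
    · have : 0 ≤ C * 48 ^ τ * ψ n := mul_nonneg (by positivity) (hψpos n).le
      rw [hD]
      linarith
    · refine h3.trans ?_
      rw [mul_one_div, div_le_div_iff₀ hQ2 (by positivity), hD]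
      nlinarith
  refine summable_of_sum_range_le (c := ∑ n ∈ Finset.range (Q (I + 1)), ψ n ^ τ + D * ∑' i, S i)
    (fun n => Real.rpow_nonneg (hψpos n).le τ) fun k => ?_
  have hsum : ∀ k, ∑ n ∈ Finset.range (Q (I + 1 + k)), ψ n ^ τ ≤
      ∑ n ∈ Finset.range (Q (I + 1)), ψ n ^ τ +
        D * ∑ i ∈ Finset.Ico (I + 1) (I + 1 + k), S i := by
    intro k
    induction k with
    | zero => simp
    | succ k ih =>
      rw [← add_assoc, Finset.sum_Ico_succ_top (by omega), mul_add, ← add_assoc,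
        ← Finset.sum_range_add_sum_Ico _ (hQmono (Nat.lt_succ_self (I + 1 + k))).le]
      exact add_le_add ih (hblock _ (by omega))
  calc ∑ n ∈ Finset.range k, ψ n ^ τ ≤ ∑ n ∈ Finset.range (Q (I + 1 + k)), ψ n ^ τ :=
        Finset.sum_le_sum_of_subset_of_nonneg
          (Finset.range_subset_range.2 (by have := hQmono.le_apply (x := I + 1 + k); omega))
          fun n _ _ => Real.rpow_nonneg (hψpos n).le τ
    _ ≤ _ := hsum k
    _ ≤ _ := by
        gcongr
        exact hSsum.sum_le_tsum _ fun i _ => hS0 i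

/-- The set of points approximated infinitely often by the forward orbit of `0` under an ergodic
rotation, at a non-increasing rate, is null or conull. -/
lemma iInter_iUnion_ball_ae_eq_empty_or_univ {α : UnitAddCircle} (hα : addOrderOf α = 0)
    {ψ : ℕ → ℝ} (hψ : Antitone ψ) :
    (⋂ N : ℕ, ⋃ n ≥ N, ball (n • α) (ψ n)) =ᵐ[volume] (∅ : Set UnitAddCircle) ∨
      (⋂ N : ℕ, ⋃ n ≥ N, ball (n • α) (ψ n)) =ᵐ[volume] (univ : Set UnitAddCircle) := by
  refine (AddCircle.ergodic_add_left.2 hα).ae_empty_or_univ_of_preimage_ae_le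
    (MeasurableSet.iInter fun N => (isOpen_biUnion fun _ _ =>
      isOpen_ball).measurableSet).nullMeasurableSet (LE.le.eventuallyLE ?_)
  intro s hs
  simp only [mem_preimage, mem_iInter, mem_iUnion] at hs ⊢
  intro N
  obtain ⟨n, hn, hs⟩ := hs (N + 1)
  obtain ⟨m, rfl⟩ : ∃ m, n = m + 1 := ⟨n - 1, by omega⟩
  refine ⟨m, by omega, ?_⟩
  rw [succ_nsmul', mem_ball, dist_add_left] at hs
  exact hs.trans_le (hψ m.le_succ)

lemma ae_of_ae_unitAddCircle {p : UnitAddCircle → Prop} (hp : ∀ᵐ s, p s) :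
    ∀ᵐ s : ℝ, p (s : UnitAddCircle) := by
  rw [← Measure.restrict_univ (μ := (volume : Measure ℝ)), ← iUnion_Ioc_intCast ℝ,
    ae_restrict_iUnion_iff]
  exact fun n => (UnitAddCircle.measurePreserving_mk n).quasiMeasurePreserving.ae hp

theorem tseng_theorem_sufficiency
    (θ : ℝ) (hθ : Irrational θ)
    (τ : ℝ) (hτ : 1 ≤ τ) (c : ℝ) (hc : 0 < c)
    (hbad : ∀ n : ℕ, 1 ≤ n → c / (n : ℝ) ^ τ ≤ distNearestInt ((n : ℝ) * θ))
    (ψ : ℕ → ℝ) (hψpos : ∀ n, 0 < ψ n) (hψmono : ∀ m n, m ≤ n → ψ n ≤ ψ m)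
    (hdiv : ¬ Summable fun n => ψ n ^ τ) :
    ∀ᵐ s ∂(volume : Measure ℝ),
      {n : ℕ | distNearestInt ((n : ℝ) * θ - s) < ψ n}.Infinite := by
  have hψ : Antitone ψ := fun m n hmn => hψmono m n hmn
  have hα : addOrderOf (θ : UnitAddCircle) = 0 := by
    rw [addOrderOf_eq_zero_iff']
    intro n hn h0
    have h1 := hbad n hn
    rw [← norm_nsmul_coe_eq_distNearestInt, h0, norm_zero] at h1
    have : (0 : ℝ) < n := by exact_mod_cast hn
    exact h1.not_gt (by positivity)
  rcases iInter_iUnion_ball_ae_eq_empty_or_univ hα hψ with h | h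
  · have hlim := tendsto_measure_iInter_atTop (μ := (volume : Measure UnitAddCircle))
      (s := fun N : ℕ => ⋃ n ≥ N, ball (n • (θ : UnitAddCircle)) (ψ n))
      (fun N => (isOpen_biUnion fun _ _ => isOpen_ball).measurableSet.nullMeasurableSet)
      (fun M N hMN => biUnion_subset_biUnion_left fun n hn => le_trans hMN hn)
      ⟨0, measure_ne_top _ _⟩
    rw [ae_eq_empty.1 h] at hlim
    obtain ⟨N, hN⟩ := (hlim.eventually_lt_const
      (show (0 : ℝ≥0∞) < ENNReal.ofReal (1 / 240) by simp)).exists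
    refine absurd (summable_rpow_of_measureReal_le hτ hc hbad hψpos hψ (N := N) ?_) hdiv
    refine ENNReal.toReal_le_of_le_ofReal (by norm_num) ((measure_mono ?_).trans hN.le)
    exact iUnion₂_mono fun n _ => closedBall_subset_ball (half_lt_self (hψpos n))
  · filter_upwards [ae_of_ae_unitAddCircle (eventuallyEq_univ.1 h)] with s hs
    rw [← Nat.frequently_atTop_iff_infinite, frequently_atTop]
    intro N
    obtain ⟨n, hn, hs⟩ := mem_iUnion₂.1 (mem_iInter.1 hs N)
    refine ⟨n, hn, ?_⟩
    rw [mem_ball', dist_eq_norm, ← AddCircle.coe_nsmul, ← AddCircle.coe_sub,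
      UnitAddCircle.norm_eq, nsmul_eq_mul] at hs
    exact hs
end

section
/- Let φ be positive non-decreasing tending to infinity and θ irrational with convergent denominators q_k. Then for almost all s ∈ ℝ, ‖nθ − s‖ < 1/(n·φ(n)) holds for infinitely many n if and only if ∑_{k≥0} log(min(φ(q_k), q_{k+1}/q_k))/φ(q_k) = ∞. -/
open MeasureTheory Filter Real
open scoped ENNReal Classical

/-- The properties of the sequence of convergent denominators of a point `x` of the circle
on which the metric theory of its orbit depends. -/
structure IsDenomSeq (x : UnitAddCircle) (q : ℕ → ℕ) : Prop where
  zero : q 0 = 1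
  le_succ : ∀ k, q k ≤ q (k + 1)
  add_le : ∀ k, q k + q (k + 1) ≤ q (k + 2)
  norm_le : ∀ k, ‖q k • x‖ ≤ 1 / q (k + 1)
  le_norm : ∀ k n, 0 < n → n < q k → 1 / (2 * q k : ℝ) ≤ ‖n • x‖

section ContinuedFraction

open GenContFract

theorem not_terminatedAt_of_irrational {θ : ℝ} (hθ : Irrational θ) (n : ℕ) :
    ¬ (GenContFract.of θ).TerminatedAt n := by
  intro h
  obtain ⟨r, hr⟩ := (terminates_iff_rat θ).1 ⟨n, h⟩
  exact hθ ⟨r, hr.symm⟩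

theorem exists_s_get?_of_irrational {θ : ℝ} (hθ : Irrational θ) (n : ℕ) :
    ∃ z : ℤ, 1 ≤ z ∧ (GenContFract.of θ).s.get? n = some ⟨1, (z : ℝ)⟩ := by
  obtain ⟨gp, hgp⟩ := Option.ne_none_iff_exists'.mp (not_terminatedAt_of_irrational hθ n)
  obtain ⟨ha, z, hz⟩ := of_partNum_eq_one_and_exists_int_partDen_eq hgp
  refine ⟨z, ?_, ?_⟩
  · have := of_one_le_get?_partDen (partDen_eq_s_b hgp)
    rw [hz] at this
    exact_mod_cast this
  · rw [hgp, ← ha, ← hz]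

theorem exists_int_eq_nums {θ : ℝ} (hθ : Irrational θ) (n : ℕ) :
    ∃ z : ℤ, (GenContFract.of θ).nums n = z := by
  induction n using Nat.twoStepInduction with
  | zero => exact ⟨⌊θ⌋, by simp [of_h_eq_floor]⟩
  | one =>
    obtain ⟨z, -, hz⟩ := exists_s_get?_of_irrational hθ 0
    exact ⟨z * ⌊θ⌋ + 1, by rw [first_num_eq hz]; simp [of_h_eq_floor]⟩
  | more n h0 h1 =>
    obtain ⟨z, -, hz⟩ := exists_s_get?_of_irrational hθ (n + 1)
    obtain ⟨a, ha⟩ := h0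
    obtain ⟨b, hb⟩ := h1
    exact ⟨z * b + a, by rw [nums_recurrence hz ha hb]; push_cast; ring⟩

theorem neg_one_pow_mul_sub_convs_nonneg {θ : ℝ} (hθ : Irrational θ) (n : ℕ) :
    0 ≤ (-1) ^ n * (θ - (GenContFract.of θ).convs n) := by
  obtain ⟨ifp, hifp⟩ : ∃ ifp, IntFractPair.stream θ n = some ifp := by
    refine Option.ne_none_iff_exists'.mp fun h => ?_
    exact not_terminatedAt_of_irrational hθ n
      (of_terminatedAt_n_iff_succ_nth_intFractPair_stream_eq_none.2
        ((IntFractPair.stream_isSeq θ) h))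
  have hsub := sub_convs_eq hifp
  simp only at hsub
  rw [hsub]
  split_ifs with h
  · simp
  · have h1 : 0 ≤ ((GenContFract.of θ).contsAux (n + 1)).b := zero_le_of_contsAux_b
    have h2 : 0 ≤ ((GenContFract.of θ).contsAux n).b := zero_le_of_contsAux_b
    have h3 := IntFractPair.nth_stream_fr_nonneg hifp
    rw [mul_div_assoc', ← mul_pow]
    simp only [mul_neg, mul_one, neg_neg, one_pow]
    positivity

/-- Consecutive convergents give a unimodular pair of approximations of opposite signs, so no
smaller denominator approximates better. -/
theorem le_abs_of_unimodular {θ : ℝ} {a b c d n m ε : ℤ} (hε : ε * ε = 1)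
    (hdet : a * d - b * c = ε) (hb : 0 < b) (hn : 0 < n) (hnd : n < d)
    (hsign : (b * θ - a) * (d * θ - c) ≤ 0) :
    |b * θ - a| ≤ |n * θ - m| := by
  set A := b * θ - a with hA
  set B := d * θ - c with hB
  set u : ℤ := ε * (d * m - c * n)
  set v : ℤ := ε * (a * n - b * m)
  have hn' : n = u * b + v * d := by
    linear_combination (-n) * hε + (- n * ε) * hdet
  have hm' : m = u * a + v * c := by
    linear_combination (-m) * hε + (- m * ε) * hdet
  have hu : u ≠ 0 := by
    intro hu
    rw [hu] at hn'
    have hv : 0 < v := by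
      by_contra hv
      nlinarith
    nlinarith
  have hexp : (n : ℝ) * θ - m = u * A + v * B := by
    rw [hn', hm', hA, hB]; push_cast; ring
  have huv : u * v ≤ 0 := by
    by_contra! h
    rcases pos_and_pos_or_neg_and_neg_of_mul_pos h with ⟨h1, h2⟩ | ⟨h1, h2⟩
    · nlinarith
    · nlinarith
  have hu1 : (1 : ℝ) ≤ |(u : ℝ)| := by exact_mod_cast Int.one_le_abs hu
  have huv' : (u : ℝ) * v ≤ 0 := by exact_mod_cast huv
  have hprod : 0 ≤ (u * A) * (v * B) := by
    have := mul_nonneg_of_nonpos_of_nonpos huv' hsign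
    nlinarith
  have habs : |u * A| ≤ |u * A + v * B| := by
    refine sq_le_sq.1 ?_
    nlinarith [sq_nonneg ((v : ℝ) * B)]
  rw [hexp]
  refine le_trans ?_ habs
  rw [abs_mul]
  nlinarith [abs_nonneg A]

theorem isDenomSeq_of_irrational {θ : ℝ} (hθ : Irrational θ) {q : ℕ → ℕ}
    (hq : ∀ k, (q k : ℝ) = (GenContFract.of θ).dens k) :
    IsDenomSeq (θ : UnitAddCircle) q := by
  have hzero : q 0 = 1 := by exact_mod_cast (hq 0).trans zeroth_den_eq_one
  have hle (k : ℕ) : q k ≤ q (k + 1) := by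
    have : (q k : ℝ) ≤ q (k + 1) := by rw [hq, hq]; exact of_den_mono
    exact_mod_cast this
  have hadd (k : ℕ) : q k + q (k + 1) ≤ q (k + 2) := by
    obtain ⟨z, hz1, hz⟩ := exists_s_get?_of_irrational hθ (k + 1)
    have h := dens_recurrence hz (hq k).symm (hq (k + 1)).symm
    rw [← hq] at h
    have hz1' : (1 : ℝ) ≤ z := by exact_mod_cast hz1
    have : (q k : ℝ) + q (k + 1) ≤ q (k + 2) := by
      rw [h]
      nlinarith [(q (k + 1)).cast_nonneg (α := ℝ)]
    exact_mod_cast this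
  have hpos (k : ℕ) : 0 < q k := by
    have : q 0 ≤ q k := monotone_nat_of_le_succ hle (Nat.zero_le k)
    omega
  have hposR (k : ℕ) : (0 : ℝ) < q k := by exact_mod_cast hpos k
  choose p hp using exists_int_eq_nums hθ
  have hconv (k : ℕ) : (GenContFract.of θ).convs k = p k / q k := by
    rw [← hp, hq]; rfl
  have hmul (k : ℕ) : (q k : ℝ) * θ - p k = q k * (θ - (GenContFract.of θ).convs k) := by
    rw [hconv]; have := (hposR k).ne'; field_simp
  have hupper (k : ℕ) : |(q k : ℝ) * θ - p k| ≤ 1 / q (k + 1) := by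
    have h := abs_sub_convs_le (not_terminatedAt_of_irrational hθ k)
    rw [← hq, ← hq] at h
    rw [hmul, abs_mul, abs_of_pos (hposR k)]
    calc (q k : ℝ) * |θ - (GenContFract.of θ).convs k|
        ≤ q k * (1 / (q k * q (k + 1))) := by gcongr
      _ = 1 / q (k + 1) := by have := (hposR k).ne'; field_simp
  have hdet (k : ℕ) : p k * (q (k + 1) : ℤ) - q k * p (k + 1) = (-1) ^ (k + 1) := by
    have h := SimpContFract.determinant (s := SimpContFract.of θ) (n := k)
      (not_terminatedAt_of_irrational hθ k)
    have h' : (p k : ℝ) * q (k + 1) - q k * p (k + 1) = (-1) ^ (k + 1) := by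
      rw [← hp, ← hp, hq, hq]; exact h
    exact_mod_cast h'
  have hsgn (k : ℕ) : 0 ≤ (-1) ^ k * ((q k : ℝ) * θ - p k) := by
    rw [hmul]
    have := mul_nonneg (hposR k).le (neg_one_pow_mul_sub_convs_nonneg hθ k)
    linarith
  have habs (k : ℕ) : |(q k : ℝ) * θ - p k| = (-1) ^ k * ((q k : ℝ) * θ - p k) := by
    rw [← abs_of_nonneg (hsgn k), abs_mul, abs_pow]; simp
  have hsq (k : ℕ) : ((-1 : ℝ) ^ k) * (-1) ^ k = 1 := by rw [← mul_pow]; simp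
  have hlower (k : ℕ) : 1 / (2 * q (k + 1) : ℝ) ≤ |(q k : ℝ) * θ - p k| := by
    have hid : (q (k + 1) : ℝ) * |(q k : ℝ) * θ - p k|
        + q k * |(q (k + 1) : ℝ) * θ - p (k + 1)| = 1 := by
      have h' : (p k : ℝ) * q (k + 1) - q k * p (k + 1) = (-1) ^ (k + 1) := by
        exact_mod_cast hdet k
      rw [habs, habs, pow_succ]
      rw [pow_succ] at h'
      linear_combination (-1 * (-1) ^ k) * h' + hsq k
    have h1 := hupper (k + 1)
    rw [le_div_iff₀ (hposR _)] at h1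
    have h2 : (q k : ℝ) + q (k + 1) ≤ q (k + 1 + 1) := by exact_mod_cast hadd k
    have h3 : (q k : ℝ) ≤ q (k + 1) := by exact_mod_cast hle k
    rw [div_le_iff₀ (by have := hposR (k + 1); positivity)]
    nlinarith [abs_nonneg ((q (k + 1) : ℝ) * θ - p (k + 1))]
  have hsign (k : ℕ) : ((q k : ℝ) * θ - p k) * ((q (k + 1) : ℝ) * θ - p (k + 1)) ≤ 0 := by
    have h := mul_nonneg (hsgn k) (hsgn (k + 1))
    rw [pow_succ] at h
    have e : (-1 : ℝ) ^ k * ((q k : ℝ) * θ - p k) *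
        ((-1) ^ k * -1 * ((q (k + 1) : ℝ) * θ - p (k + 1))) =
        -(((-1 : ℝ) ^ k * (-1) ^ k) * (((q k : ℝ) * θ - p k) * ((q (k + 1) : ℝ) * θ - p (k + 1)))) := by
      ring
    rw [e, hsq] at h
    linarith
  have hnorm (n : ℕ) : ‖n • (θ : UnitAddCircle)‖ = |(n : ℝ) * θ - round ((n : ℝ) * θ)| := by
    rw [← UnitAddCircle.norm_eq, ← nsmul_eq_mul, AddCircle.coe_nsmul]
  refine ⟨hzero, hle, hadd, fun k => ?_, fun k n hn hnk => ?_⟩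
  · rw [hnorm]
    exact (round_le _ _).trans (hupper k)
  · rw [hnorm]
    cases k with
    | zero => omega
    | succ k =>
      refine (hlower k).trans ?_
      have := le_abs_of_unimodular (θ := θ) (a := p k) (b := q k) (c := p (k + 1))
        (d := q (k + 1)) (n := n) (m := round ((n : ℝ) * θ)) (ε := (-1) ^ (k + 1))
        (by rw [← mul_pow]; simp) (hdet k) (by exact_mod_cast hpos k) (by exact_mod_cast hn)
        (by exact_mod_cast hnk) (by exact_mod_cast hsign k)
      exact_mod_cast this

end ContinuedFraction

section Circle

theorem UnitAddCircle.volume_real_ball (x : UnitAddCircle) (r : ℝ) :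
    volume.real (Metric.ball x r) = max 0 (min 1 (2 * r)) := by
  rw [← measureReal_congr (AddCircle.closedBall_ae_eq_ball (x := x) (ε := r)), measureReal_def,
    AddCircle.volume_closedBall, ENNReal.toReal_ofReal', max_comm]

theorem UnitAddCircle.volume_real_ball_of_le {r : ℝ} (hr : 0 ≤ r) (hr' : 2 * r ≤ 1)
    (x : UnitAddCircle) :
    volume.real (Metric.ball x r) = 2 * r := by
  rw [UnitAddCircle.volume_real_ball, min_eq_right hr', max_eq_right (by positivity)]

theorem UnitAddCircle.volume_real_ball_le {r : ℝ} (hr : 0 ≤ r) (x : UnitAddCircle) :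
    volume.real (Metric.ball x r) ≤ 2 * r := by
  rw [UnitAddCircle.volume_real_ball]
  exact max_le (by positivity) (min_le_right _ _)

/-- Moving the centre of a ball of the circle by `d` uncovers a set of measure at most `2 * d`. -/
theorem UnitAddCircle.volume_real_ball_sdiff_ball_le {r d : ℝ} {x y : UnitAddCircle} (hr : 0 ≤ r)
    (hxy : dist x y ≤ d) :
    volume.real (Metric.ball x r \ Metric.ball y r) ≤ 2 * min r d := by
  have hd : 0 ≤ d := dist_nonneg.trans hxy
  rw [mul_min_of_nonneg _ _ zero_le_two]
  refine le_min ((measureReal_mono Set.sdiff_subset).trans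
    (UnitAddCircle.volume_real_ball_le hr x)) ?_
  have hsub : Metric.ball x r \ Metric.ball y r ⊆ Metric.ball x r \ Metric.ball x (r - d) := by
    rintro s ⟨hs, hs'⟩
    refine ⟨hs, fun hs'' => hs' ?_⟩
    rw [Metric.mem_ball] at hs'' ⊢
    linarith [dist_triangle s x y]
  calc volume.real (Metric.ball x r \ Metric.ball y r)
      ≤ volume.real (Metric.ball x r \ Metric.ball x (r - d)) :=
        measureReal_mono hsub (measure_ne_top _ _)
    _ = volume.real (Metric.ball x r) - volume.real (Metric.ball x (r - d)) :=
        measureReal_sdiff (Metric.ball_subset_ball (by linarith)) Metric.isOpen_ball.measurableSet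
    _ ≤ 2 * d := by
        rw [UnitAddCircle.volume_real_ball, UnitAddCircle.volume_real_ball]
        simp only [max_def, min_def]
        split_ifs <;> linarith

/-- A `d`-separated family has at most `1 + 2 * r / d` members in a ball of radius `r`. -/
theorem UnitAddCircle.card_mul_le_of_separated {ι : Type*} {J : Finset ι}
    {y : ι → UnitAddCircle} {d r : ℝ}
    (hd : 0 < d) (hd1 : d ≤ 1) (hr : 0 ≤ r)
    (hsep : ∀ i ∈ J, ∀ j ∈ J, i ≠ j → d ≤ dist (y i) (y j)) (c : UnitAddCircle)
    (hJ : ∀ j ∈ J, y j ∈ Metric.ball c r) :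
    (J.card : ℝ) * d ≤ 2 * r + d := by
  have hdisj : Set.PairwiseDisjoint (J : Set ι) fun j => Metric.ball (y j) (d / 2) := by
    intro i hi j hj hij
    exact Metric.ball_disjoint_ball (by linarith [hsep i hi j hj hij])
  have hsub : ⋃ j ∈ J, Metric.ball (y j) (d / 2) ⊆ Metric.ball c (r + d / 2) := by
    refine Set.iUnion₂_subset fun j hj => Metric.ball_subset_ball' ?_
    have := hJ j hj
    rw [Metric.mem_ball] at this
    linarith
  have h := (measureReal_mono (μ := (volume : Measure UnitAddCircle)) hsub).trans
    (UnitAddCircle.volume_real_ball_le (by linarith) c)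
  rw [measureReal_biUnion_finset hdisj fun j _ => Metric.isOpen_ball.measurableSet,
    Finset.sum_congr rfl fun j _ =>
      UnitAddCircle.volume_real_ball_of_le (by linarith : 0 ≤ d / 2) (by linarith) (y j),
    Finset.sum_const, nsmul_eq_mul] at h
  linarith

/-- Upper bound for the intersection of two unions of balls, the second one being made of
families of balls with `1 / (2 * Q)`-separated centres. -/
theorem UnitAddCircle.volume_real_iUnion_ball_inter_le {ι κ lam : Type*} (P : Finset ι)
    (x : ι → UnitAddCircle)
    (ρ : ι → ℝ) (hρ : ∀ i ∈ P, 0 ≤ ρ i) (M : Finset κ) (J : Finset lam)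
    (y : κ → lam → UnitAddCircle) (σ : κ → ℝ) {Q : ℝ} (hQ : 1 ≤ Q)
    (hσ : ∀ m ∈ M, 0 ≤ σ m) (hσQ : ∀ m ∈ M, σ m ≤ 1 / (4 * Q))
    (hsep : ∀ m ∈ M, ∀ i ∈ J, ∀ j ∈ J, i ≠ j → 1 / (2 * Q) ≤ dist (y m i) (y m j)) :
    volume.real ((⋃ i ∈ P, Metric.ball (x i) (ρ i)) ∩
      ⋃ p ∈ M ×ˢ J, Metric.ball (y p.1 p.2) (σ p.1)) ≤
    (∑ m ∈ M, 2 * σ m) * ∑ i ∈ P, (2 + 4 * Q * ρ i) := by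
  have hQ0 : 0 < Q := by linarith
  set N : κ → ι → Finset lam := fun m i => J.filter fun j => y m j ∈ Metric.ball (x i) (ρ i + σ m)
  have hsub : ((⋃ i ∈ P, Metric.ball (x i) (ρ i)) ∩
      ⋃ p ∈ M ×ˢ J, Metric.ball (y p.1 p.2) (σ p.1)) ⊆
      ⋃ m ∈ M, ⋃ i ∈ P, ⋃ j ∈ N m i, Metric.ball (y m j) (σ m) := by
    rintro s ⟨hs, hs'⟩
    simp only [Set.mem_iUnion, exists_prop] at hs hs' ⊢
    obtain ⟨i, hi, hsi⟩ := hs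
    obtain ⟨⟨m, j⟩, hmj, hsj⟩ := hs'
    obtain ⟨hm, hj⟩ := Finset.mem_product.1 hmj
    refine ⟨m, hm, i, hi, j, Finset.mem_filter.2 ⟨hj, ?_⟩, hsj⟩
    rw [Metric.mem_ball] at *
    linarith [dist_triangle_left (y m j) (x i) s]
  have hcard : ∀ m ∈ M, ∀ i ∈ P, ((N m i).card : ℝ) ≤ 2 + 4 * Q * ρ i := by
    intro m hm i hi
    have h := UnitAddCircle.card_mul_le_of_separated (J := N m i) (y := y m) (d := 1 / (2 * Q))
      (r := ρ i + σ m)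
      (by positivity) (by rw [div_le_one (by positivity)]; linarith)
      (add_nonneg (hρ i hi) (hσ m hm))
      (fun i hi j hj hij => hsep m hm i (Finset.mem_filter.1 hi).1 j (Finset.mem_filter.1 hj).1 hij)
      (x i) (fun j hj => (Finset.mem_filter.1 hj).2)
    have h1 := hσQ m hm
    rw [le_div_iff₀ (by positivity)] at h1
    rw [mul_one_div, div_le_iff₀ (by positivity)] at h
    have e : (2 * (ρ i + σ m) + 1 / (2 * Q)) * (2 * Q) = 4 * Q * ρ i + σ m * (4 * Q) + 1 := by
      field_simp; ring
    linarith
  calc _ ≤ volume.real (⋃ m ∈ M, ⋃ i ∈ P, ⋃ j ∈ N m i, Metric.ball (y m j) (σ m)) :=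
        measureReal_mono hsub (measure_ne_top _ _)
    _ ≤ ∑ m ∈ M, ∑ i ∈ P, ∑ j ∈ N m i, volume.real (Metric.ball (y m j) (σ m)) := by
        refine (measureReal_biUnion_finset_le _ _).trans (Finset.sum_le_sum fun m _ => ?_)
        refine (measureReal_biUnion_finset_le _ _).trans (Finset.sum_le_sum fun i _ => ?_)
        exact measureReal_biUnion_finset_le _ _
    _ ≤ ∑ m ∈ M, ∑ i ∈ P, 2 * σ m * (2 + 4 * Q * ρ i) := by
        refine Finset.sum_le_sum fun m hm => Finset.sum_le_sum fun i hi => ?_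
        refine (Finset.sum_le_card_nsmul _ _ _ fun j _ =>
          UnitAddCircle.volume_real_ball_le (hσ m hm) (y m j)).trans ?_
        rw [nsmul_eq_mul, mul_comm]
        exact mul_le_mul_of_nonneg_left (hcard m hm i hi) (by linarith [hσ m hm])
    _ = _ := by rw [Finset.sum_mul_sum]

end Circle

section SecondMoment

variable {Ω : Type*} [MeasurableSpace Ω] {μ : Measure Ω} [IsProbabilityMeasure μ]

/-- A form of the Chung–Erdős inequality. -/
theorem two_mul_mul_sum_sub_le_measureReal_biUnion {ι : Type*} (s : Finset ι) {A : ι → Set Ω}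
    (hA : ∀ i, MeasurableSet (A i)) (t : ℝ) :
    2 * t * ∑ i ∈ s, μ.real (A i) - t ^ 2 * ∑ i ∈ s, ∑ j ∈ s, μ.real (A i ∩ A j) ≤
      μ.real (⋃ i ∈ s, A i) := by
  set U := ⋃ i ∈ s, A i
  have hU : MeasurableSet U := Finset.measurableSet_biUnion s fun i _ => hA i
  have hint (B : Set Ω) (hB : MeasurableSet B) :
      Integrable (B.indicator (1 : Ω → ℝ)) μ := (integrable_const (1 : ℝ)).indicator hB
  have hpt (ω : Ω) : 2 * t * ∑ i ∈ s, (A i).indicator (1 : Ω → ℝ) ω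
      - t ^ 2 * ∑ i ∈ s, ∑ j ∈ s, (A i ∩ A j).indicator (1 : Ω → ℝ) ω ≤
      U.indicator (1 : Ω → ℝ) ω := by
    simp only [Set.inter_indicator_one, Pi.mul_apply]
    rw [← Finset.sum_mul_sum]
    by_cases h : ω ∈ U
    · rw [Set.indicator_of_mem h, Pi.one_apply]
      nlinarith [sq_nonneg (1 - t * ∑ i ∈ s, (A i).indicator (1 : Ω → ℝ) ω)]
    · have hz : ∑ i ∈ s, (A i).indicator (1 : Ω → ℝ) ω = 0 := by
        refine Finset.sum_eq_zero fun i hi => Set.indicator_of_notMem (fun hmem => h ?_) _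
        exact Set.mem_biUnion hi hmem
      rw [hz, Set.indicator_of_notMem h]
      simp
  have h1 : Integrable (fun ω => 2 * t * ∑ i ∈ s, (A i).indicator (1 : Ω → ℝ) ω) μ :=
    (integrable_finsetSum _ fun i _ => hint _ (hA i)).const_mul _
  have h2 : Integrable
      (fun ω => t ^ 2 * ∑ i ∈ s, ∑ j ∈ s, (A i ∩ A j).indicator (1 : Ω → ℝ) ω) μ :=
    (integrable_finsetSum _ fun i _ => integrable_finsetSum _ fun j _ =>
      hint _ ((hA i).inter (hA j))).const_mul _
  have h := integral_mono (h1.sub h2) (hint U hU) hpt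
  have e := integral_sub h1 h2
  simp only [Pi.sub_apply] at h
  rw [e, integral_const_mul, integral_const_mul,
    integral_finsetSum _ fun i _ => hint _ (hA i),
    integral_finsetSum _ fun i _ => integrable_finsetSum _ fun j _ =>
      hint _ ((hA i).inter (hA j)), integral_indicator_one hU,
    Finset.sum_congr rfl fun i _ => integral_indicator_one (μ := μ) (hA i),
    Finset.sum_congr rfl fun i _ => integral_finsetSum _ fun j _ =>
      hint _ ((hA i).inter (hA j))] at h
  rwa [Finset.sum_congr rfl fun i _ => Finset.sum_congr rfl fun j _ =>
      integral_indicator_one (μ := μ) ((hA i).inter (hA j))] at h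

theorem Finset.sum_sum_le_two_mul_of_symm (s : Finset ℕ) (f : ℕ → ℕ → ℝ)
    (hf : ∀ i j, 0 ≤ f i j) (hsymm : ∀ i j, f i j = f j i) :
    ∑ i ∈ s, ∑ j ∈ s, f i j ≤ 2 * ∑ i ∈ s, ∑ j ∈ s with j ≤ i, f i j := by
  have h : ∀ i ∈ s, ∀ j ∈ s, f i j ≤ (if j ≤ i then f i j else 0) + if i ≤ j then f i j else 0 := by
    intro i _ j _
    have := hf i j
    split_ifs <;> linarith
  refine (Finset.sum_le_sum fun i hi => Finset.sum_le_sum (h i hi)).trans ?_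
  simp only [Finset.sum_add_distrib, Finset.sum_filter]
  rw [Finset.sum_comm (f := fun i j => if i ≤ j then f i j else 0), two_mul]
  gcongr with i _ j _
  rw [hsymm]

/-- A quantitative second Borel–Cantelli lemma: events that are quasi-independent with respect to
a divergent weight have a limit superior of positive measure. -/
theorem measure_limsup_pos_of_quasi_independent {A : ℕ → Set Ω} (hA : ∀ l, MeasurableSet (A l))
    {S : ℕ → ℝ} {C : ℝ} (hC : 0 < C) (hS : ∀ l, 0 ≤ S l) (hdiv : ¬ Summable S)
    (hmeas : ∀ l, S l ≤ μ.real (A l))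
    (hquasi : ∀ l, ∀ s : Finset ℕ,
      ∑ j ∈ s with j ≤ l, μ.real (A l ∩ A j) ≤ C * S l * (1 + ∑ j ∈ s, S j)) :
    0 < μ (limsup A atTop) := by
  have htend := (not_summable_iff_tendsto_nat_atTop_of_nonneg hS).1 hdiv
  have key (K : ℕ) : 1 / (4 * C) ≤ μ.real (⋃ l ≥ K, A l) := by
    obtain ⟨L, hL, hKL⟩ := ((htend.eventually_ge_atTop (1 + ∑ l ∈ Finset.range K, S l)).and
      (eventually_ge_atTop K)).exists
    set s := Finset.Ico K L
    set M := ∑ l ∈ s, S l with hM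
    have hM1 : 1 ≤ M := by
      rw [hM, Finset.sum_Ico_eq_sub _ hKL]
      linarith
    have hW : ∑ i ∈ s, ∑ j ∈ s, μ.real (A i ∩ A j) ≤ 4 * C * M ^ 2 := by
      refine (Finset.sum_sum_le_two_mul_of_symm s _ (fun _ _ => measureReal_nonneg)
        fun i j => by rw [Set.inter_comm]).trans ?_
      have := Finset.sum_le_sum fun l (_ : l ∈ s) => hquasi l s
      rw [← Finset.sum_mul, ← Finset.mul_sum, ← hM] at this
      nlinarith [mul_pos hC (by linarith : 0 < M)]
    have hMle : M ≤ ∑ l ∈ s, μ.real (A l) := Finset.sum_le_sum fun l _ => hmeas l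
    have h := two_mul_mul_sum_sub_le_measureReal_biUnion (μ := μ) s hA (1 / (4 * C * M))
    have hM0 : 0 < M := by linarith
    refine le_trans ?_ (h.trans (measureReal_mono ?_ (measure_ne_top _ _)))
    · calc 1 / (4 * C) = 2 * (1 / (4 * C * M)) * M - (1 / (4 * C * M)) ^ 2 * (4 * C * M ^ 2) := by
            field_simp; ring
        _ ≤ _ := by gcongr
    · exact Set.iUnion₂_mono' fun l hl => ⟨l, (Finset.mem_Ico.1 hl).1, subset_rfl⟩
  have hanti : Antitone fun K => ⋃ l ≥ K, A l := fun K L hKL =>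
    Set.iUnion₂_mono' fun l hl => ⟨l, hKL.trans hl, subset_rfl⟩
  have hlim := tendsto_measure_iInter_atTop (μ := μ)
    (fun K => (MeasurableSet.iUnion fun l => MeasurableSet.iUnion fun _ =>
      hA l : MeasurableSet (⋃ l ≥ K, A l)).nullMeasurableSet) hanti ⟨0, measure_ne_top _ _⟩
  have hle : ENNReal.ofReal (1 / (4 * C)) ≤ μ (⋂ K, ⋃ l ≥ K, A l) :=
    ge_of_tendsto' hlim fun K => by
      rw [Function.comp_apply, ← ofReal_measureReal (measure_ne_top _ _)]
      exact ENNReal.ofReal_le_ofReal (key K)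
  rw [limsup_eq_iInf_iSup_of_nat]
  simp only [Set.iInf_eq_iInter, Set.iSup_eq_iUnion]
  exact lt_of_lt_of_le (ENNReal.ofReal_pos.2 (by positivity)) hle

end SecondMoment

section RealSeries

theorem log_div_le_sum_Ico_one_div {m n : ℕ} (hm : 0 < m) (hmn : m ≤ n) :
    log (n / m) ≤ ∑ i ∈ Finset.Ico m n, 1 / (i : ℝ) := by
  induction n, hmn using Nat.le_induction with
  | base => simp [hm.ne']
  | succ n hmn ih =>
    have hm' : (0 : ℝ) < m := by exact_mod_cast hm
    have hn' : (0 : ℝ) < n := by exact_mod_cast hm.trans_le hmn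
    rw [Finset.sum_Ico_succ_top hmn]
    have h := log_le_sub_one_of_pos (show 0 < ((n + 1 : ℕ) : ℝ) / n by positivity)
    have e : ((n + 1 : ℕ) : ℝ) / n - 1 = 1 / n := by push_cast; field_simp; ring
    rw [e, log_div (by positivity) hn'.ne'] at h
    rw [log_div hn'.ne' hm'.ne'] at ih
    rw [log_div (by positivity) hm'.ne']
    linarith

theorem sum_Ico_one_div_le_two_mul_log_div {m n : ℕ} (hm : 0 < m) (hmn : m ≤ n) :
    ∑ i ∈ Finset.Ico m n, 1 / (i : ℝ) ≤ 2 * log (n / m) := by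
  induction n, hmn using Nat.le_induction with
  | base => simp [hm.ne']
  | succ n hmn ih =>
    have hm' : (0 : ℝ) < m := by exact_mod_cast hm
    have hn' : (1 : ℝ) ≤ n := by exact_mod_cast hm.trans_le hmn
    have hn0 : (0 : ℝ) < n := by linarith
    rw [Finset.sum_Ico_succ_top hmn]
    have h := one_sub_inv_le_log_of_pos (show 0 < ((n + 1 : ℕ) : ℝ) / n by positivity)
    have e : 1 / (n : ℝ) ≤ 2 * (1 - (((n + 1 : ℕ) : ℝ) / n)⁻¹) := by
      have : 1 - (((n + 1 : ℕ) : ℝ) / n)⁻¹ = 1 / (n + 1) := by push_cast; field_simp; ring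
      rw [this, mul_one_div, div_le_div_iff₀ hn0 (by positivity)]
      linarith
    rw [log_div (by positivity) hn0.ne'] at h
    rw [log_div hn0.ne' hm'.ne'] at ih
    rw [log_div (by positivity) hm'.ne']
    linarith

/-- If `0 ≤ u ≤ log ψ` with `ψ` monotone, then shifting `ψ` does not affect the convergence of
the series `∑ u k / ψ k`. -/
theorem summable_div_of_summable_div_succ {u ψ : ℕ → ℝ} (hψ : Monotone ψ) (hψ1 : ∀ k, 1 ≤ ψ k)
    (hu : ∀ k, 0 ≤ u k) (hu' : ∀ k, u k ≤ log (ψ k))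
    (h : Summable fun k => u k / ψ (k + 1)) : Summable fun k => u k / ψ k := by
  set G : ℕ → ℝ := fun k => (1 + log (ψ k)) / ψ k
  have hpos (k : ℕ) : 0 < ψ k := zero_lt_one.trans_le (hψ1 k)
  have hG (k : ℕ) : 0 ≤ G k := div_nonneg (by linarith [log_nonneg (hψ1 k)]) (hpos k).le
  have hle (k : ℕ) : u k / ψ k - u k / ψ (k + 1) ≤ G k - G (k + 1) := by
    have hinv : 1 / ψ (k + 1) ≤ 1 / ψ k := one_div_le_one_div_of_le (hpos k) (hψ k.le_succ)
    have hlog := log_le_sub_one_of_pos (div_pos (hpos (k + 1)) (hpos k))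
    rw [log_div (hpos _).ne' (hpos _).ne'] at hlog
    have h1 : log (ψ k) / ψ k - log (ψ k) / ψ (k + 1) ≤ G k - G (k + 1) := by
      have h2 : (log (ψ (k + 1)) - log (ψ k)) / ψ (k + 1) ≤ (ψ (k + 1) / ψ k - 1) / ψ (k + 1) :=
        div_le_div_of_nonneg_right hlog (hpos _).le
      have e : (ψ (k + 1) / ψ k - 1) / ψ (k + 1) = 1 / ψ k - 1 / ψ (k + 1) := by
        have := (hpos k).ne'; have := (hpos (k + 1)).ne'; field_simp
      rw [e, sub_div] at h2
      simp only [G, add_div]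
      linarith
    have h3 : (log (ψ k) - u k) * (1 / ψ k - 1 / ψ (k + 1)) ≥ 0 :=
      mul_nonneg (by linarith [hu' k]) (by linarith)
    have e3 : (log (ψ k) - u k) * (1 / ψ k - 1 / ψ (k + 1)) =
      (log (ψ k) / ψ k - log (ψ k) / ψ (k + 1)) - (u k / ψ k - u k / ψ (k + 1)) := by ring
    linarith
  have hsum : Summable fun k => u k / ψ k - u k / ψ (k + 1) := by
    refine summable_of_sum_range_le (c := G 0) (fun k => ?_) fun n => ?_
    · exact sub_nonneg.2 (div_le_div_of_nonneg_left (hu k) (hpos k) (hψ k.le_succ))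
    · refine (Finset.sum_le_sum fun k _ => hle k).trans ?_
      rw [Finset.sum_range_sub']
      linarith [hG n]
  simpa using hsum.add h

theorem log_min_div_le_sum {a : ℕ} {R Ψ Φ : ℝ} (hRa : R < a + 1) (hR : 1 ≤ R)
    (hΨ : 4 ≤ Ψ) (hΨΦ : Ψ ≤ Φ) :
    log (min Ψ R) / (16 * Φ) ≤
      ∑ m ∈ Finset.Icc 1 a, min (1 / ((m + 1) * Φ)) (1 / (4 * R)) := by
  set m₀ := ⌈R / Ψ⌉₊
  have hΨ0 : 0 < Ψ := by linarith
  have hΦ0 : 0 < Φ := by linarith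
  have hm₀ : 0 < m₀ := Nat.ceil_pos.2 (by positivity)
  have hm₀R : (0 : ℝ) < m₀ := by exact_mod_cast hm₀
  have hceil : R ≤ m₀ * Ψ := (div_le_iff₀ hΨ0).1 (Nat.le_ceil _)
  have hlt : (m₀ : ℝ) < R / Ψ + 1 := Nat.ceil_lt_add_one (by positivity)
  have hm₀a : m₀ ≤ a + 1 := by
    refine Nat.ceil_le.2 ?_
    rw [div_le_iff₀ hΨ0]
    push_cast
    nlinarith
  have hlog : log (min Ψ R) / 2 ≤ log (R / m₀) := by
    rcases le_or_gt R Ψ with h | h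
    · have : m₀ ≤ 1 := Nat.ceil_le.2 (by rw [div_le_iff₀ hΨ0]; simpa using h)
      have h1 : m₀ = 1 := by omega
      rw [min_eq_right h, h1]
      simp only [Nat.cast_one, div_one]
      linarith [log_nonneg hR]
    · rw [min_eq_left h.le]
      have h1 : Ψ / 2 ≤ R / m₀ := by
        rw [div_le_div_iff₀ two_pos hm₀R]
        have : R / Ψ * Ψ = R := by field_simp
        nlinarith
      have h2 := log_le_log (by positivity) h1
      rw [log_div hΨ0.ne' two_ne_zero] at h2
      have h3 : 2 * log 2 ≤ log Ψ := by
        rw [← log_rpow two_pos]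
        exact log_le_log (by positivity) (by norm_num; linarith)
      linarith
  have hharm : log (R / m₀) ≤ ∑ i ∈ Finset.Ico m₀ (a + 1), 1 / (i : ℝ) := by
    refine le_trans (log_le_log (by positivity) ?_) (log_div_le_sum_Ico_one_div hm₀ hm₀a)
    push_cast
    gcongr
  have hterm : ∀ i ∈ Finset.Ico m₀ (a + 1),
      1 / (8 * Φ) * (1 / (i : ℝ)) ≤ min (1 / ((i + 1) * Φ)) (1 / (4 * R)) := by
    intro i hi
    have hi1 : (m₀ : ℝ) ≤ i := by exact_mod_cast (Finset.mem_Ico.1 hi).1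
    have hi2 : (1 : ℝ) ≤ i := by exact_mod_cast hm₀.trans_le (Finset.mem_Ico.1 hi).1
    have hRi : R ≤ i * Φ := hceil.trans (by gcongr)
    rw [one_div_mul_one_div]
    refine le_min ?_ ?_ <;> refine one_div_le_one_div_of_le (by positivity) ?_ <;> nlinarith
  calc log (min Ψ R) / (16 * Φ) = 1 / (8 * Φ) * (log (min Ψ R) / 2) := by
        field_simp; ring
    _ ≤ 1 / (8 * Φ) * ∑ i ∈ Finset.Ico m₀ (a + 1), 1 / (i : ℝ) := by
        gcongr; exact hlog.trans hharm
    _ ≤ ∑ i ∈ Finset.Ico m₀ (a + 1), min (1 / (((i : ℝ) + 1) * Φ)) (1 / (4 * R)) := by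
        rw [Finset.mul_sum]; exact Finset.sum_le_sum hterm
    _ ≤ _ := by
        refine Finset.sum_le_sum_of_subset_of_nonneg ?_ fun i _ _ => by positivity
        intro i hi
        rw [Finset.mem_Ico] at hi
        rw [Finset.mem_Icc]
        omega

theorem sum_min_le_log_min_div {Q Q' : ℕ} {Φ : ℝ} (hQ : 0 < Q) (hQQ' : Q ≤ Q') (hΦ : 4 ≤ Φ) :
    ∑ n ∈ Finset.Ico Q Q', min (1 / (n * Φ)) (1 / (Q' : ℝ)) ≤
      3 * (log (min Φ (Q' / Q)) / Φ) := by
  have hQ0 : (0 : ℝ) < Q := by exact_mod_cast hQ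
  have hQ'0 : (0 : ℝ) < Q' := by exact_mod_cast hQ.trans_le hQQ'
  have hΦ0 : 0 < Φ := by linarith
  have hbound {m : ℕ} (hm : 0 < m) (hmQ : m ≤ Q') :
      ∑ n ∈ Finset.Ico m Q', min (1 / (n * Φ)) (1 / (Q' : ℝ)) ≤ 2 * log (Q' / m) / Φ := by
    calc ∑ n ∈ Finset.Ico m Q', min (1 / (n * Φ)) (1 / (Q' : ℝ))
        ≤ ∑ n ∈ Finset.Ico m Q', 1 / (n : ℝ) * (1 / Φ) :=
          Finset.sum_le_sum fun n _ => (min_le_left _ _).trans_eq (one_div_mul_one_div _ _).symm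
      _ ≤ 2 * log (Q' / m) * (1 / Φ) := by
          rw [← Finset.sum_mul]
          gcongr
          exact sum_Ico_one_div_le_two_mul_log_div hm hmQ
      _ = _ := by ring
  rcases le_or_gt ((Q' : ℝ) / Q) Φ with h | h
  · rw [min_eq_right h]
    refine (hbound hQ hQQ').trans ?_
    have h1 : 0 ≤ log ((Q' : ℝ) / Q) / Φ :=
      div_nonneg (log_nonneg (by rw [one_le_div hQ0]; exact_mod_cast hQQ')) hΦ0.le
    rw [mul_div_assoc]
    linarith
  · rw [min_eq_left h.le]
    set m := ⌈(Q' : ℝ) / Φ⌉₊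
    have hm : 0 < m := Nat.ceil_pos.2 (by positivity)
    have hm0 : (0 : ℝ) < m := by exact_mod_cast hm
    have hceil : (Q' : ℝ) ≤ m * Φ := (div_le_iff₀ hΦ0).1 (Nat.le_ceil _)
    have hlt : (m : ℝ) < Q' / Φ + 1 := Nat.ceil_lt_add_one (by positivity)
    have hmQ' : m ≤ Q' := Nat.ceil_le.2 (by rw [div_le_iff₀ hΦ0]; nlinarith)
    have hQm : Q ≤ m := by
      have : (Q : ℝ) ≤ m := by
        rw [lt_div_iff₀ hQ0] at h
        by_contra! hc
        nlinarith
      exact_mod_cast this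
    rw [← Finset.sum_Ico_consecutive _ hQm hmQ']
    have h1 : ∑ n ∈ Finset.Ico Q m, min (1 / (n * Φ)) (1 / (Q' : ℝ)) ≤ 1 / Φ := by
      refine (Finset.sum_le_card_nsmul _ _ _ fun n _ => min_le_right _ _).trans ?_
      have hc : ((m - Q : ℕ) : ℝ) ≤ Q' / Φ := by
        have hQ1 : (1 : ℝ) ≤ Q := by exact_mod_cast hQ
        rw [Nat.cast_sub hQm]
        linarith
      rw [Nat.card_Ico, nsmul_eq_mul]
      calc ((m - Q : ℕ) : ℝ) * (1 / Q') ≤ Q' / Φ * (1 / Q') := by gcongr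
        _ = 1 / Φ := by field_simp
    have h2 : log (Q' / m) ≤ log Φ :=
      log_le_log (by positivity) (by rw [div_le_iff₀ hm0]; linarith)
    have h3 : 1 ≤ log Φ := by
      rw [le_log_iff_exp_le hΦ0]
      linarith [exp_one_lt_d9]
    calc _ ≤ 1 / Φ + 2 * log (Q' / m) / Φ := add_le_add h1 (hbound hm hmQ')
      _ = (1 + 2 * log (Q' / m)) / Φ := by ring
      _ ≤ 3 * log Φ / Φ := by gcongr; linarith
      _ = _ := by ring

end RealSeries

namespace IsDenomSeq

variable {x : UnitAddCircle} {q : ℕ → ℕ}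

theorem mono (hq : IsDenomSeq x q) : Monotone q := monotone_nat_of_le_succ hq.le_succ

theorem pos (hq : IsDenomSeq x q) (k : ℕ) : 0 < q k := by
  have := hq.mono (Nat.zero_le k)
  have := hq.zero
  omega

theorem cast_pos (hq : IsDenomSeq x q) (k : ℕ) : (0 : ℝ) < q k := by exact_mod_cast hq.pos k

theorem self_le (hq : IsDenomSeq x q) (k : ℕ) : k ≤ q k := by
  induction k using Nat.twoStepInduction with
  | zero => omega
  | one => exact hq.pos 1
  | more k _ ih =>
    have := hq.pos k
    have := hq.add_le k
    omega

theorem tendsto_atTop (hq : IsDenomSeq x q) : Tendsto q atTop atTop :=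
  tendsto_atTop_mono hq.self_le tendsto_id

theorem sum_range_le (hq : IsDenomSeq x q) (l : ℕ) :
    ∑ i ∈ Finset.range l, q (i + 1) ≤ 3 * q l := by
  induction l using Nat.twoStepInduction with
  | zero => simp
  | one => simp; omega
  | more l ih _ =>
    rw [Finset.sum_range_succ, Finset.sum_range_succ]
    have := hq.add_le l
    have := hq.le_succ l
    change _ + q (l + 1) + q (l + 2) ≤ 3 * q (l + 2)
    omega

theorem one_div_le_dist (hq : IsDenomSeq x q) {k m n : ℕ} (hmn : m ≠ n) (h1 : m < n + q k)
    (h2 : n < m + q k) : 1 / (2 * q k : ℝ) ≤ dist (m • x) (n • x) := by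
  wlog h : n < m generalizing m n
  · rw [dist_comm]
    exact this hmn.symm h2 h1 (by omega)
  have := hq.le_norm k (m - n) (by omega) (by omega)
  rwa [sub_nsmul x h.le, ← sub_eq_add_neg, ← dist_eq_norm] at this

theorem exists_mem_Ico (hq : IsDenomSeq x q) {K n : ℕ} (hn : q K ≤ n) :
    ∃ k, K ≤ k ∧ q k ≤ n ∧ n < q (k + 1) := by
  have hex : ∃ k, n < q (K + k + 1) :=
    ⟨n, lt_of_lt_of_le (by omega) (hq.self_le (K + n + 1))⟩
  refine ⟨K + Nat.find hex, by omega, ?_, Nat.find_spec hex⟩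
  rcases h : Nat.find hex with - | k
  · simpa using hn
  · have := Nat.find_min hex (m := k) (by omega)
    rw [← add_assoc]
    omega

end IsDenomSeq

/-- The points of the circle that are approximated by infinitely many points of the orbit of `x`,
the `n`-th one within distance less than `1 / (n * φ n)`. -/
def inhomApproxSet (x : UnitAddCircle) (φ : ℕ → ℝ) : Set UnitAddCircle :=
  {s | {n : ℕ | ‖n • x - s‖ < 1 / ((n : ℝ) * φ n)}.Infinite}

theorem inhomApproxSet_eq_limsup (x : UnitAddCircle) (φ : ℕ → ℝ) :
    inhomApproxSet x φ =
      limsup (fun n : ℕ => Metric.ball (n • x) (1 / ((n : ℝ) * φ n))) atTop := by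
  ext s
  rw [mem_limsup_iff_frequently_mem, Nat.frequently_atTop_iff_infinite]
  simp only [Metric.mem_ball', dist_eq_norm]
  rfl

theorem measurableSet_inhomApproxSet (x : UnitAddCircle) (φ : ℕ → ℝ) :
    MeasurableSet (inhomApproxSet x φ) := by
  rw [inhomApproxSet_eq_limsup]
  exact MeasurableSet.measurableSet_limsup fun n => Metric.isOpen_ball.measurableSet

section Radius

variable {φ : ℕ → ℝ}

theorem one_div_mul_le_one_div_mul (hφpos : ∀ n, 0 < φ n) (hφmono : Monotone φ)
    {m n : ℕ} (hm : 0 < m) (hmn : m ≤ n) :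
    1 / ((n : ℝ) * φ n) ≤ 1 / ((m : ℝ) * φ m) := by
  have hm' : (0 : ℝ) < m := by exact_mod_cast hm
  have := hφpos m
  have := hφmono hmn
  gcongr

/-- The zero-one law, from the ergodicity of the rotation by `x`. -/
theorem inhomApproxSet_ae_eq_empty_or_univ (hφpos : ∀ n, 0 < φ n) (hφmono : Monotone φ)
    {x : UnitAddCircle} (hx : addOrderOf x = 0) :
    inhomApproxSet x φ =ᵐ[volume] (∅ : Set UnitAddCircle) ∨
      inhomApproxSet x φ =ᵐ[volume] Set.univ := by
  have herg : Ergodic ((-x) + · : UnitAddCircle → UnitAddCircle) volume :=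
    AddCircle.ergodic_add_left.2 (by rwa [addOrderOf_neg])
  refine herg.ae_empty_or_univ_of_ae_le_preimage
    (measurableSet_inhomApproxSet x φ).nullMeasurableSet (LE.le.eventuallyLE ?_)
  intro s hs
  refine Set.infinite_of_forall_exists_gt fun N => ?_
  obtain ⟨n, hn, hNn⟩ := Set.Infinite.exists_gt hs (N + 1)
  obtain ⟨n, rfl⟩ : ∃ n', n = n' + 1 := ⟨n - 1, by omega⟩
  refine ⟨n, ?_, by omega⟩
  simp only [Set.mem_ofPred_eq] at hn ⊢
  have e : n • x - (-x + s) = (n + 1) • x - s := by rw [succ_nsmul]; abel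
  rw [e]
  exact hn.trans_le (one_div_mul_le_one_div_mul hφpos hφmono (by omega) n.le_succ)

end Radius

section Divergence

variable {x : UnitAddCircle} {q : ℕ → ℕ} {φ : ℕ → ℝ}

/-- The radius of the balls around the points `n • x`, `m * q l ≤ n < (m + 1) * q l`. -/
noncomputable def blockRadius (q : ℕ → ℕ) (φ : ℕ → ℝ) (l m : ℕ) : ℝ :=
  min (1 / (((m + 1) * q l) * φ (q (l + 2)))) (1 / (4 * q (l + 1)))

/-- The pairs `(m, j)` such that the number `m * q l + j` belongs to the `l`-th block. -/
def blockIndex (q : ℕ → ℕ) (l : ℕ) : Finset (ℕ × ℕ) :=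
  Finset.Icc 1 (q (l + 1) / q l) ×ˢ Finset.range (q l)

/-- The union of the shrunken balls around the points of the orbit in the `l`-th block. -/
noncomputable def blockSet (x : UnitAddCircle) (q : ℕ → ℕ) (φ : ℕ → ℝ) (l : ℕ) :
    Set UnitAddCircle :=
  ⋃ p ∈ blockIndex q l, Metric.ball ((p.1 * q l + p.2) • x) (blockRadius q φ l p.1)

/-- Half of the measure of the `l`-th block. -/
noncomputable def blockWeight (q : ℕ → ℕ) (φ : ℕ → ℝ) (l : ℕ) : ℝ :=
  ∑ p ∈ blockIndex q l, blockRadius q φ l p.1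

theorem measurableSet_blockSet (l : ℕ) : MeasurableSet (blockSet x q φ l) :=
  Finset.measurableSet_biUnion _ fun _ _ => Metric.isOpen_ball.measurableSet

theorem mem_blockIndex {l : ℕ} {p : ℕ × ℕ} :
    p ∈ blockIndex q l ↔ (1 ≤ p.1 ∧ p.1 ≤ q (l + 1) / q l) ∧ p.2 < q l := by
  simp [blockIndex]

theorem le_block_of_mem {l : ℕ} {p : ℕ × ℕ} (hp : p ∈ blockIndex q l) :
    q l ≤ p.1 * q l + p.2 := by
  rw [mem_blockIndex] at hp
  nlinarith

theorem block_lt_of_mem {l : ℕ} {p : ℕ × ℕ} (hp : p ∈ blockIndex q l) :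
    p.1 * q l + p.2 < q l + q (l + 1) := by
  rw [mem_blockIndex] at hp
  have h1 := Nat.mul_le_mul_right (q l) hp.1.2
  have h2 := Nat.div_mul_le_self (q (l + 1)) (q l)
  omega

theorem blockWeight_eq (l : ℕ) :
    blockWeight q φ l =
      ∑ m ∈ Finset.Icc 1 (q (l + 1) / q l), q l * blockRadius q φ l m := by
  simp [blockWeight, blockIndex, Finset.sum_product]

theorem blockRadius_nonneg (hφpos : ∀ n, 0 < φ n) (l m : ℕ) : 0 ≤ blockRadius q φ l m := by
  have := hφpos (q (l + 2))
  unfold blockRadius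
  positivity

theorem blockWeight_nonneg (hφpos : ∀ n, 0 < φ n) (l : ℕ) : 0 ≤ blockWeight q φ l :=
  Finset.sum_nonneg fun p _ => blockRadius_nonneg hφpos l p.1

theorem volume_real_blockSet (hφpos : ∀ n, 0 < φ n) (hq : IsDenomSeq x q) (l : ℕ) :
    volume.real (blockSet x q φ l) = 2 * blockWeight q φ l := by
  have hq1 : (1 : ℝ) ≤ q (l + 1) := by exact_mod_cast hq.pos (l + 1)
  have hr (m : ℕ) : blockRadius q φ l m ≤ 1 / (4 * q (l + 1)) := min_le_right _ _
  have hr' : (1 : ℝ) / (4 * q (l + 1)) ≤ 1 / 4 :=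
    one_div_le_one_div_of_le (by norm_num) (by linarith)
  have hdisj : Set.PairwiseDisjoint (blockIndex q l : Set (ℕ × ℕ))
      fun p => Metric.ball ((p.1 * q l + p.2) • x) (blockRadius q φ l p.1) := by
    intro p hp p' hp' hne
    refine Metric.ball_disjoint_ball ?_
    have hne' : p.1 * q l + p.2 ≠ p'.1 * q l + p'.2 := by
      intro h
      have h1 := (mem_blockIndex.1 hp).2
      have h2 := (mem_blockIndex.1 hp').2
      have e2 : p.2 = p'.2 := by
        simpa [Nat.mod_eq_of_lt h1, Nat.mod_eq_of_lt h2] using congrArg (· % q l) h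
      have e3 : p.1 = p'.1 := Nat.eq_of_mul_eq_mul_right (hq.pos l) (by omega)
      exact hne (Prod.ext e3 e2)
    have hd := hq.one_div_le_dist (k := l + 1) hne'
      (by linarith [block_lt_of_mem hp, le_block_of_mem hp'])
      (by linarith [block_lt_of_mem hp', le_block_of_mem hp])
    have e : (1 : ℝ) / (2 * q (l + 1)) = 1 / (4 * q (l + 1)) + 1 / (4 * q (l + 1)) := by
      field_simp; ring
    linarith [hr p.1, hr p'.1]
  rw [blockSet, measureReal_biUnion_finset hdisj fun _ _ => Metric.isOpen_ball.measurableSet,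
    blockWeight, Finset.mul_sum]
  exact Finset.sum_congr rfl fun p _ => UnitAddCircle.volume_real_ball_of_le
    (blockRadius_nonneg hφpos l p.1) (by linarith [hr p.1]) _

theorem volume_real_blockSet_inter_le (hφpos : ∀ n, 0 < φ n) (hq : IsDenomSeq x q) {i l : ℕ} :
    volume.real (blockSet x q φ i ∩ blockSet x q φ l) ≤
      2 * blockWeight q φ l * (2 * (q (i + 1) / q l) + 4 * blockWeight q φ i) := by
  have hl := hq.cast_pos l
  have h := UnitAddCircle.volume_real_iUnion_ball_inter_le (blockIndex q i)
    (fun p => (p.1 * q i + p.2) • x) (fun p => blockRadius q φ i p.1)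
    (fun p _ => blockRadius_nonneg hφpos i p.1) (Finset.Icc 1 (q (l + 1) / q l))
    (Finset.range (q l)) (fun m j => (m * q l + j) • x) (blockRadius q φ l) (Q := q l)
    (by exact_mod_cast hq.pos l) (fun m _ => blockRadius_nonneg hφpos l m)
    (fun m _ => (min_le_right _ _).trans (by
      have : (q l : ℝ) ≤ q (l + 1) := by exact_mod_cast hq.le_succ l
      gcongr))
    (fun m _ i hi j hj hij => by
      rw [Finset.mem_range] at hi hj
      exact hq.one_div_le_dist (by omega) (by omega) (by omega))
  refine h.trans ?_
  have e1 : ∑ m ∈ Finset.Icc 1 (q (l + 1) / q l), 2 * blockRadius q φ l m =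
      2 * blockWeight q φ l / q l := by
    rw [blockWeight_eq, ← Finset.mul_sum, ← Finset.mul_sum]
    field_simp
  have hcard : ((blockIndex q i).card : ℝ) ≤ q (i + 1) := by
    have : (blockIndex q i).card ≤ q (i + 1) := by
      simpa [blockIndex] using Nat.div_mul_le_self (q (i + 1)) (q i)
    exact_mod_cast this
  have e2 : ∑ p ∈ blockIndex q i, (2 + 4 * (q l : ℝ) * blockRadius q φ i p.1) =
      2 * (blockIndex q i).card + 4 * q l * blockWeight q φ i := by
    rw [Finset.sum_add_distrib, ← Finset.mul_sum, ← blockWeight, Finset.sum_const, nsmul_eq_mul]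
    ring
  rw [e1, e2]
  calc 2 * blockWeight q φ l / q l * (2 * (blockIndex q i).card + 4 * q l * blockWeight q φ i)
      ≤ 2 * blockWeight q φ l / q l * (2 * q (i + 1) + 4 * q l * blockWeight q φ i) := by
        have := blockWeight_nonneg (q := q) hφpos l
        gcongr
    _ = _ := by field_simp

theorem sum_volume_real_blockSet_inter_le (hφpos : ∀ n, 0 < φ n) (hq : IsDenomSeq x q)
    (l : ℕ) (s : Finset ℕ) :
    ∑ i ∈ s with i ≤ l, volume.real (blockSet x q φ l ∩ blockSet x q φ i) ≤
      14 * blockWeight q φ l * (1 + ∑ i ∈ s, blockWeight q φ i) := by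
  have hl := hq.cast_pos l
  have hW := blockWeight_nonneg (q := q) hφpos
  set f : ℕ → ℝ := fun i => 2 * blockWeight q φ l * (2 * (q (i + 1) / q l) + 4 * blockWeight q φ i)
  have hf (i : ℕ) : 0 ≤ f i := by
    have := hW l
    have := hW i
    positivity
  have hle : ∀ i ∈ s.filter (· ≤ l), volume.real (blockSet x q φ l ∩ blockSet x q φ i) ≤
      (if i = l then 2 * blockWeight q φ l else 0) + if i < l then f i else 0 := by
    intro i hi
    have hil := (Finset.mem_filter.1 hi).2
    rcases hil.eq_or_lt with h | h
    · simp [h, volume_real_blockSet hφpos hq]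
    · rw [if_neg h.ne, if_pos h, zero_add, Set.inter_comm]
      exact volume_real_blockSet_inter_le hφpos hq
  have hdiag : ∑ i ∈ s with i ≤ l, (if i = l then 2 * blockWeight q φ l else 0) ≤
      2 * blockWeight q φ l := by
    rw [Finset.sum_ite_eq']
    split_ifs
    · exact le_rfl
    · linarith [hW l]
  have hqsum : ∑ i ∈ (s.filter (· ≤ l)).filter (· < l), (q (i + 1) : ℝ) / q l ≤ 3 := by
    rw [← Finset.sum_div, div_le_iff₀ hl]
    have h3 : ∑ i ∈ Finset.range l, (q (i + 1) : ℝ) ≤ 3 * q l := by exact_mod_cast hq.sum_range_le l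
    refine le_trans (Finset.sum_le_sum_of_subset_of_nonneg (fun i hi => ?_)
      fun i _ _ => (q (i + 1)).cast_nonneg) h3
    exact Finset.mem_range.2 (Finset.mem_filter.1 hi).2
  have hwsum : ∑ i ∈ (s.filter (· ≤ l)).filter (· < l), blockWeight q φ i ≤
      ∑ i ∈ s, blockWeight q φ i :=
    Finset.sum_le_sum_of_subset_of_nonneg
      ((Finset.filter_subset _ _).trans (Finset.filter_subset _ _)) fun i _ _ => hW i
  have hoff : ∑ i ∈ s with i ≤ l, (if i < l then f i else 0) ≤
      2 * blockWeight q φ l * (2 * 3 + 4 * ∑ i ∈ s, blockWeight q φ i) := by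
    rw [← Finset.sum_filter]
    simp only [f]
    rw [← Finset.mul_sum, Finset.sum_add_distrib, ← Finset.mul_sum, ← Finset.mul_sum]
    have := hW l
    gcongr
  refine (Finset.sum_le_sum hle).trans ?_
  rw [Finset.sum_add_distrib]
  have : 0 ≤ blockWeight q φ l * ∑ i ∈ s, blockWeight q φ i :=
    mul_nonneg (hW l) (Finset.sum_nonneg fun i _ => hW i)
  linarith

theorem limsup_blockSet_subset (hφpos : ∀ n, 0 < φ n) (hφmono : Monotone φ) (hq : IsDenomSeq x q) :
    limsup (blockSet x q φ) atTop ⊆ inhomApproxSet x φ := by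
  intro s hs
  rw [mem_limsup_iff_frequently_mem, frequently_atTop] at hs
  refine Set.infinite_of_forall_exists_gt fun N => ?_
  obtain ⟨l, hl, hsl⟩ := hs (N + 1)
  simp only [blockSet, Set.mem_iUnion, exists_prop] at hsl
  obtain ⟨p, hp, hsp⟩ := hsl
  have hn := le_block_of_mem hp
  have hn2 : p.1 * q l + p.2 ≤ q (l + 2) := (block_lt_of_mem hp).le.trans (hq.add_le l)
  have hqN := hl.trans (hq.self_le l)
  refine ⟨p.1 * q l + p.2, ?_, by omega⟩
  rw [Metric.mem_ball', dist_eq_norm] at hsp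
  refine hsp.trans_le ((min_le_left _ _).trans ?_)
  have hpos : (0 : ℝ) < (p.1 * q l + p.2 : ℕ) := by exact_mod_cast (by omega)
  have hle : ((p.1 * q l + p.2 : ℕ) : ℝ) ≤ (p.1 + 1) * q l := by
    have : p.1 * q l + p.2 ≤ (p.1 + 1) * q l := by
      rw [add_mul, one_mul]
      exact Nat.add_le_add_left (mem_blockIndex.1 hp).2.le _
    exact_mod_cast this
  have := hφpos (p.1 * q l + p.2)
  have := hφmono hn2
  gcongr

theorem log_min_div_le_blockWeight (hφpos : ∀ n, 0 < φ n) (hφmono : Monotone φ)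
    (hq : IsDenomSeq x q) {l : ℕ}
    (hφ4 : 4 ≤ φ (q l)) :
    log (min (φ (q l)) ((q (l + 1) : ℝ) / q l)) / (16 * φ (q (l + 2))) ≤ blockWeight q φ l := by
  have hl := hq.cast_pos l
  have hl1 := hq.cast_pos (l + 1)
  have hΦ := hφpos (q (l + 2))
  refine (log_min_div_le_sum (a := q (l + 1) / q l) (Nat.lt_floor_add_one _ |>.trans_eq
    (by rw [Nat.floor_div_eq_div])) ?_ hφ4 (hφmono (hq.mono (by omega)))).trans_eq ?_
  · rw [one_le_div hl]
    exact_mod_cast hq.le_succ l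
  · rw [blockWeight_eq]
    refine Finset.sum_congr rfl fun m _ => ?_
    rw [blockRadius, mul_min_of_nonneg _ _ hl.le]
    congr 1 <;> field_simp

theorem measure_inhomApproxSet_pos (hφpos : ∀ n, 0 < φ n) (hφmono : Monotone φ)
    (hφtop : Tendsto φ atTop atTop) (hq : IsDenomSeq x q)
    (hdiv : ¬ Summable fun k => log (min (φ (q k)) ((q (k + 1) : ℝ) / q k)) / φ (q k)) :
    0 < volume (inhomApproxSet x φ) := by
  refine lt_of_lt_of_le ?_ (measure_mono (limsup_blockSet_subset hφpos hφmono hq))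
  have : IsProbabilityMeasure (volume : Measure UnitAddCircle) := ⟨UnitAddCircle.measure_univ⟩
  refine measure_limsup_pos_of_quasi_independent measurableSet_blockSet (C := 14) (by norm_num)
    (blockWeight_nonneg (q := q) hφpos) (fun hsum => hdiv ?_)
    (fun l => ?_) (sum_volume_real_blockSet_inter_le hφpos hq)
  · obtain ⟨k₀, hk₀⟩ := eventually_atTop.1
      ((hφtop.comp hq.tendsto_atTop).eventually_ge_atTop 4)
    simp only [Function.comp_apply] at hk₀
    set u : ℕ → ℝ := fun k => log (min (φ (q k)) ((q (k + 1) : ℝ) / q k))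
    set ψ : ℕ → ℝ := fun k => φ (q k)
    have hψ : Monotone ψ := hφmono.comp hq.mono
    have hR (k : ℕ) : 1 ≤ (q (k + 1) : ℝ) / q k := by
      rw [one_le_div (hq.cast_pos k)]
      exact_mod_cast hq.le_succ k
    have hψ4 (k : ℕ) : 4 ≤ ψ (k + k₀) := hk₀ _ (by omega)
    have hu0 (k : ℕ) : 0 ≤ u (k + k₀) := log_nonneg (le_min (by linarith [hψ4 k]) (hR _))
    have hu1 (k : ℕ) : u (k + k₀) ≤ log (ψ (k + k₀)) :=
      log_le_log (lt_min (by linarith [hψ4 k]) (by linarith [hR (k + k₀)])) (min_le_left _ _)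
    have h2 : Summable fun k => u (k + k₀) / ψ (k + 1 + 1 + k₀) := by
      refine Summable.of_nonneg_of_le (fun k => div_nonneg (hu0 k) (hφpos _).le) (fun k => ?_)
        (((summable_nat_add_iff k₀).2 hsum).mul_left 16)
      have := log_min_div_le_blockWeight hφpos hφmono hq (hψ4 k)
      rw [div_le_iff₀ (by have := hφpos (q (k + k₀ + 2)); positivity)] at this
      rw [show k + 1 + 1 + k₀ = k + k₀ + 2 by omega, div_le_iff₀ (hφpos _)]
      linarith
    have h1 : Summable fun k => u (k + k₀) / ψ (k + 1 + k₀) :=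
      summable_div_of_summable_div_succ (ψ := fun k => ψ (k + 1 + k₀))
        (fun a b hab => hψ (by omega)) (fun k => by linarith [hψ4 (k + 1)]) hu0
        (fun k => (hu1 k).trans (log_le_log (by linarith [hψ4 k]) (hψ (by omega)))) h2
    refine (summable_nat_add_iff k₀).1 ?_
    exact summable_div_of_summable_div_succ (ψ := fun k => ψ (k + k₀))
        (fun a b hab => hψ (by omega)) (fun k => by linarith [hψ4 k]) hu0 hu1 h1
  · rw [volume_real_blockSet hφpos hq]
    linarith [blockWeight_nonneg (q := q) hφpos l]

end Divergence

section Convergence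

variable {x : UnitAddCircle} {q : ℕ → ℕ} {φ : ℕ → ℝ}

/-- A point of `ball (n • x) (1 / (n φ n))` with `n ≥ q K` either lies in one of the balls indexed
by `n < q K`, enlarged to radius `1 / (q K φ (q K))`, or in a difference of two balls of the same
radius, whose centres differ by some `q k • x`. -/
theorem inhomApproxSet_subset (hφpos : ∀ n, 0 < φ n) (hφmono : Monotone φ) (hq : IsDenomSeq x q)
    (K : ℕ) : inhomApproxSet x φ ⊆
      (⋃ n ∈ Finset.range (q K), Metric.ball (n • x) (1 / (q K * φ (q K)))) ∪
      ⋃ k, ⋃ n ∈ Finset.Ico (q (k + K)) (q (k + K + 1)),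
        Metric.ball (n • x) (1 / (n * φ n)) \ Metric.ball ((n - q (k + K)) • x) (1 / (n * φ n)) := by
  intro s hs
  have key : ∀ n, q K ≤ n → s ∈ Metric.ball (n • x) (1 / (n * φ n)) → s ∈
      (⋃ n ∈ Finset.range (q K), Metric.ball (n • x) (1 / (q K * φ (q K)))) ∪
      ⋃ k, ⋃ n ∈ Finset.Ico (q (k + K)) (q (k + K + 1)),
        Metric.ball (n • x) (1 / (n * φ n)) \
          Metric.ball ((n - q (k + K)) • x) (1 / (n * φ n)) := by
    intro n
    induction n using Nat.strong_induction_on with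
    | h n ih =>
      intro hn hsn
      obtain ⟨k, hk, hkn, hnk⟩ := hq.exists_mem_Ico hn
      obtain ⟨k, rfl⟩ := Nat.exists_eq_add_of_le' hk
      by_cases h : s ∈ Metric.ball ((n - q (k + K)) • x) (1 / (n * φ n))
      · rcases lt_or_ge (n - q (k + K)) (q K) with h' | h'
        · left
          simp only [Set.mem_iUnion, Finset.mem_range]
          exact ⟨_, h', Metric.ball_subset_ball
            (one_div_mul_le_one_div_mul hφpos hφmono (hq.pos K) hn) h⟩
        · have := hq.pos (k + K)
          exact ih _ (by omega) h' (Metric.ball_subset_ball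
            (one_div_mul_le_one_div_mul hφpos hφmono ((hq.pos K).trans_le h') (by omega)) h)
      · right
        simp only [Set.mem_iUnion, Finset.mem_Ico]
        exact ⟨k, n, ⟨hkn, hnk⟩, hsn, h⟩
  obtain ⟨n, hn, hlt⟩ := hs.exists_gt (q K)
  refine key n hlt.le ?_
  rw [Metric.mem_ball, dist_comm, dist_eq_norm]
  exact hn

theorem measure_inhomApproxSet_eq_zero (hφpos : ∀ n, 0 < φ n) (hφmono : Monotone φ)
    (hφtop : Tendsto φ atTop atTop) (hq : IsDenomSeq x q)
    (hsum : Summable fun k => log (min (φ (q k)) ((q (k + 1) : ℝ) / q k)) / φ (q k)) :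
    volume (inhomApproxSet x φ) = 0 := by
  set a : ℕ → ℝ := fun k => log (min (φ (q k)) ((q (k + 1) : ℝ) / q k)) / φ (q k)
  have hφq : Tendsto (fun k => φ (q k)) atTop atTop := hφtop.comp hq.tendsto_atTop
  have hbound : ∀ᶠ K in atTop, volume (inhomApproxSet x φ) ≤
      ENNReal.ofReal (2 / φ (q K) + 6 * ∑' k, a (k + K)) := by
    obtain ⟨k₀, hk₀⟩ := eventually_atTop.1 (hφq.eventually_ge_atTop 4)
    filter_upwards [eventually_ge_atTop k₀] with K hK
    have h4 (k : ℕ) : 4 ≤ φ (q (k + K)) := hk₀ _ (by omega)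
    have ha (k : ℕ) : 0 ≤ a (k + K) := by
      refine div_nonneg (log_nonneg (le_min (by linarith [h4 k]) ?_)) (hφpos _).le
      rw [one_le_div (hq.cast_pos _)]
      exact_mod_cast hq.le_succ _
    have hr (n : ℕ) : 0 ≤ 1 / (n * φ n) := by have := hφpos n; positivity
    have hqK := hq.cast_pos K
    have hφK := hφpos (q K)
    refine (measure_mono (inhomApproxSet_subset hφpos hφmono hq K)).trans ?_
    rw [ENNReal.ofReal_add (by positivity) (mul_nonneg (by norm_num) (tsum_nonneg ha))]
    refine (measure_union_le _ _).trans (add_le_add ?_ ?_)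
    · rw [← ofReal_measureReal (measure_ne_top _ _)]
      refine ENNReal.ofReal_le_ofReal ((measureReal_biUnion_finset_le _ _).trans ?_)
      refine (Finset.sum_le_sum fun n _ =>
        UnitAddCircle.volume_real_ball_le (hr (q K)) (n • x)).trans (le_of_eq ?_)
      rw [Finset.sum_const, Finset.card_range, nsmul_eq_mul]
      field_simp
    · rw [← tsum_mul_left, ENNReal.ofReal_tsum_of_nonneg (fun k => mul_nonneg (by norm_num) (ha k))
        (((summable_nat_add_iff K).2 hsum).mul_left 6)]
      refine (measure_iUnion_le _).trans (ENNReal.tsum_le_tsum fun k => ?_)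
      rw [← ofReal_measureReal (measure_ne_top _ _)]
      refine ENNReal.ofReal_le_ofReal ((measureReal_biUnion_finset_le _ _).trans ?_)
      calc _ ≤ ∑ n ∈ Finset.Ico (q (k + K)) (q (k + K + 1)),
              2 * min (1 / (n * φ (q (k + K)))) (1 / (q (k + K + 1) : ℝ)) := by
            refine Finset.sum_le_sum fun n hn => ?_
            obtain ⟨hkn, -⟩ := Finset.mem_Ico.1 hn
            have hn0 : (0 : ℝ) < n := by exact_mod_cast (hq.pos _).trans_le hkn
            have hφk := hφpos (q (k + K))
            refine (UnitAddCircle.volume_real_ball_sdiff_ball_le (hr n)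
              (d := 1 / (q (k + K + 1) : ℝ)) ?_).trans ?_
            · rw [dist_eq_norm, sub_nsmul x hkn]
              simpa using hq.norm_le (k + K)
            · have := hφmono hkn
              gcongr
        _ ≤ 2 * (3 * a (k + K)) := by
            rw [← Finset.mul_sum]
            exact mul_le_mul_of_nonneg_left
              (sum_min_le_log_min_div (hq.pos _) (hq.le_succ _) (h4 k)) (by norm_num)
        _ = 6 * a (k + K) := by ring
  have hlim : Tendsto (fun K => ENNReal.ofReal (2 / φ (q K) + 6 * ∑' k, a (k + K))) atTop
      (nhds 0) := by
    have := (hφq.const_div_atTop 2).add ((tendsto_sum_nat_add a).const_mul 6)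
    simpa using ENNReal.tendsto_ofReal this
  exact le_antisymm (ge_of_tendsto hlim hbound) zero_le

end Convergence

section Transfer

theorem addOrderOf_coe_unitAddCircle {θ : ℝ} (hθ : Irrational θ) :
    addOrderOf (θ : UnitAddCircle) = 0 := by
  rw [addOrderOf_eq_zero_iff']
  intro n hn h
  rw [← AddCircle.coe_nsmul, AddCircle.coe_eq_zero_iff] at h
  obtain ⟨m, hm⟩ := h
  refine (hθ.natCast_mul hn.ne').ne_int m ?_
  simpa using hm.symm

theorem distNearestInt_eq_norm (y : ℝ) : distNearestInt y = ‖(y : UnitAddCircle)‖ :=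
  UnitAddCircle.norm_eq.symm

theorem setOf_distNearestInt_lt_infinite_iff (θ s : ℝ) (φ : ℕ → ℝ) :
    {n : ℕ | distNearestInt ((n : ℝ) * θ - s) < 1 / ((n : ℝ) * φ n)}.Infinite ↔
      (s : UnitAddCircle) ∈ inhomApproxSet (θ : UnitAddCircle) φ := by
  have (n : ℕ) : distNearestInt ((n : ℝ) * θ - s) = ‖n • (θ : UnitAddCircle) - s‖ := by
    rw [distNearestInt_eq_norm, AddCircle.coe_sub, ← nsmul_eq_mul, AddCircle.coe_nsmul]
  simp only [this]
  rfl

theorem ae_coe_unitAddCircle_mem_iff {E : Set UnitAddCircle} (hE : MeasurableSet E) :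
    (∀ᵐ s : ℝ, (s : UnitAddCircle) ∈ E) ↔ ∀ᵐ y : UnitAddCircle, y ∈ E := by
  constructor
  · intro h
    have hmp := AddCircle.measurePreserving_mk 1 0
    have h' := (ae_map_iff hmp.aemeasurable hE).2 (ae_restrict_of_ae h)
    rwa [hmp.map_eq] at h'
  · intro h
    have hres (t : ℤ) : ∀ᵐ s : ℝ ∂volume.restrict (Set.Ioc (t : ℝ) (t + 1)),
        (s : UnitAddCircle) ∈ E :=
      (AddCircle.measurePreserving_mk 1 (t : ℝ)).quasiMeasurePreserving.ae h
    rw [← Measure.restrict_univ (μ := (volume : Measure ℝ)), ← iUnion_Ioc_intCast ℝ,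
      ae_restrict_iUnion_iff]
    exact hres

end Transfer

theorem kim_theorem
    (θ : ℝ) (hθ : Irrational θ) (q : ℕ → ℕ)
    (hq : ∀ k, (q k : ℝ) = (GenContFract.of θ).dens k)
    (φ : ℕ → ℝ) (hφpos : ∀ n, 0 < φ n) (hφmono : ∀ m n, m ≤ n → φ m ≤ φ n)
    (hφtop : Tendsto φ atTop atTop) :
    (∀ᵐ s ∂(volume : Measure ℝ),
        {n : ℕ | distNearestInt ((n : ℝ) * θ - s) < 1 / ((n : ℝ) * φ n)}.Infinite) ↔
      ¬ Summable fun k =>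
        Real.log (min (φ (q k)) ((q (k + 1) : ℝ) / (q k : ℝ))) / φ (q k) := by
  have hden := isDenomSeq_of_irrational hθ hq
  have hmono : Monotone φ := hφmono
  simp only [setOf_distNearestInt_lt_infinite_iff]
  rw [ae_coe_unitAddCircle_mem_iff (measurableSet_inhomApproxSet _ φ)]
  constructor
  · intro h hsum
    have h0 := measure_inhomApproxSet_eq_zero hφpos hmono hφtop hden hsum
    have h1 : ∀ᵐ _ : UnitAddCircle, False :=
      (h.and (measure_eq_zero_iff_ae_notMem.1 h0)).mono fun _ hy => hy.2 hy.1
    have h2 := ae_iff.1 h1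
    simp at h2
  · intro hdiv
    have hpos := measure_inhomApproxSet_pos hφpos hmono hφtop hden hdiv
    rcases inhomApproxSet_ae_eq_empty_or_univ hφpos hmono
      (addOrderOf_coe_unitAddCircle hθ) with h | h
    · exact absurd (ae_eq_empty.1 h) hpos.ne'
    · exact eventuallyEq_univ.1 h
end
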